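/- Let (f,g,ρ) be a warped Berger solution of Ricci flow on S^1×S^3 defined on [0,T) satisfying Assumption A. Suppose the singular set is not all of S^1×S^3, i.e. there exists ξ₀ ∈ S^1 with liminf_{t↗T} M(ξ₀,t) > 0. Then the total length of the base circle, L(t) := ∫_{S^1} ρ(ξ,t) dξ, remains bounded as t ↗ T: sup_{t∈[0,T)} L(t) < ∞ (hence the diameter of the solution remains bounded as t ↗ T). -/

import Mathlib

open Real Set Filter Topology

noncomputable section

/-- Partial derivative in the first (spatial, `ξ`) variable. -/
def pd1 (φ : ℝ → ℝ → ℝ) (ξ t : ℝ) : ℝ := deriv (fun x => φ x t) ξ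

/-- Partial derivative in the second (time) variable: `φ_t`. -/
def pdt (φ : ℝ → ℝ → ℝ) (ξ t : ℝ) : ℝ := deriv (fun τ => φ ξ τ) t

/-- Derivative with respect to arclength `s` (where `ds = ρ dξ`): `φ_s := ρ⁻¹ ∂_ξ φ`. -/
def Ds (ρ φ : ℝ → ℝ → ℝ) (ξ t : ℝ) : ℝ := pd1 φ ξ t / ρ ξ t

/-- Sectional curvature `κ₁₂ = κ₃₁ = f²/g⁴ − f_s g_s/(f g)`. -/
def k12 (ρ f g : ℝ → ℝ → ℝ) (ξ t : ℝ) : ℝ :=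
  (f ξ t) ^ 2 / (g ξ t) ^ 4 - Ds ρ f ξ t * Ds ρ g ξ t / (f ξ t * g ξ t)

/-- Sectional curvature `κ₃₁ = κ₁₂`. -/
def k31 (ρ f g : ℝ → ℝ → ℝ) (ξ t : ℝ) : ℝ :=
  (f ξ t) ^ 2 / (g ξ t) ^ 4 - Ds ρ f ξ t * Ds ρ g ξ t / (f ξ t * g ξ t)

/-- Sectional curvature `κ₂₃ = (4g² − 3f²)/g⁴ − g_s²/g²`. -/
def k23 (ρ f g : ℝ → ℝ → ℝ) (ξ t : ℝ) : ℝ :=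
  (4 * (g ξ t) ^ 2 - 3 * (f ξ t) ^ 2) / (g ξ t) ^ 4 - (Ds ρ g ξ t) ^ 2 / (g ξ t) ^ 2

/-- Sectional curvature `κ₀₁ = −f_ss/f`. -/
def k01 (ρ f : ℝ → ℝ → ℝ) (ξ t : ℝ) : ℝ := -(Ds ρ (Ds ρ f) ξ t) / f ξ t

/-- Sectional curvature `κ₀₂ = κ₀₃ = −g_ss/g`. -/
def k02 (ρ g : ℝ → ℝ → ℝ) (ξ t : ℝ) : ℝ := -(Ds ρ (Ds ρ g) ξ t) / g ξ t

/-- Scalar curvature `R = κ₀₁ + 2κ₀₂ + 2κ₁₂ + κ₂₃`. -/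
def scalR (ρ f g : ℝ → ℝ → ℝ) (ξ t : ℝ) : ℝ :=
  k01 ρ f ξ t + 2 * k02 ρ g ξ t + 2 * k12 ρ f g ξ t + k23 ρ f g ξ t

/-- `M(ξ,t) := min {f(ξ,t), g(ξ,t)}`. -/
def M (f g : ℝ → ℝ → ℝ) (ξ t : ℝ) : ℝ := min (f ξ t) (g ξ t)

/-- `M̌(t) := min_{ξ ∈ S¹} M(ξ,t)`. -/
def Mcheck (f g : ℝ → ℝ → ℝ) (t : ℝ) : ℝ := ⨅ ξ : ℝ, M f g ξ t

/-- A warped Berger solution of Ricci flow on `S¹ × S³` with (finite) existence time `T`: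
smooth positive `2π`-periodic-in-`ξ` functions `f, g, ρ` on `S¹ × [0,T)` satisfying
  `f_t = f_ss + 2 (g_s/g) f_s − 2 f³/g⁴`,
  `g_t = g_ss + (f_s/f + g_s/g) g_s + 2 (f² − 2g²)/g³`,
  `(log ρ)_t = f_ss/f + 2 g_ss/g`. -/
structure WarpedBerger (T : ℝ) (f g ρ : ℝ → ℝ → ℝ) : Prop where
  T_pos : 0 < T
  f_pos : ∀ ξ t : ℝ, 0 ≤ t → t < T → 0 < f ξ t
  g_pos : ∀ ξ t : ℝ, 0 ≤ t → t < T → 0 < g ξ t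
  ρ_pos : ∀ ξ t : ℝ, 0 ≤ t → t < T → 0 < ρ ξ t
  f_per : ∀ ξ t : ℝ, f (ξ + 2 * π) t = f ξ t
  g_per : ∀ ξ t : ℝ, g (ξ + 2 * π) t = g ξ t
  ρ_per : ∀ ξ t : ℝ, ρ (ξ + 2 * π) t = ρ ξ t
  smooth : ContDiffOn ℝ (⊤ : ℕ∞)
      (fun p : ℝ × ℝ => (f p.1 p.2, g p.1 p.2, ρ p.1 p.2)) (Set.univ ×ˢ Set.Ico 0 T)
  eq_f : ∀ ξ t : ℝ, 0 < t → t < T →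
    pdt f ξ t = Ds ρ (Ds ρ f) ξ t + 2 * (Ds ρ g ξ t / g ξ t) * Ds ρ f ξ t
      - 2 * (f ξ t) ^ 3 / (g ξ t) ^ 4
  eq_g : ∀ ξ t : ℝ, 0 < t → t < T →
    pdt g ξ t = Ds ρ (Ds ρ g) ξ t
      + (Ds ρ f ξ t / f ξ t + Ds ρ g ξ t / g ξ t) * Ds ρ g ξ t
      + 2 * ((f ξ t) ^ 2 - 2 * (g ξ t) ^ 2) / (g ξ t) ^ 3
  eq_ρ : ∀ ξ t : ℝ, 0 < t → t < T →
    pdt (fun x τ => Real.log (ρ x τ)) ξ t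
      = Ds ρ (Ds ρ f) ξ t / f ξ t + 2 * (Ds ρ (Ds ρ g) ξ t / g ξ t)

/-- The Ricci curvature blows up as `t ↗ T`:
`limsup_{t↗T} max_ξ (|κ₀₁+2κ₁₂| + |κ₀₁+2κ₀₂| + |κ₀₂+κ₁₂+κ₂₃|) = ∞`, where the three
displayed quantities are the diagonal components of the Ricci tensor. -/
def RicciBlowup (T : ℝ) (f g ρ : ℝ → ℝ → ℝ) : Prop :=
  ∀ K : ℝ, ∀ t₀ : ℝ, 0 ≤ t₀ → t₀ < T → ∃ ξ t : ℝ, t₀ < t ∧ t < T ∧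
    K < |k01 ρ f ξ t + 2 * k12 ρ f g ξ t| + |k01 ρ f ξ t + 2 * k02 ρ g ξ t|
        + |k02 ρ g ξ t + k12 ρ f g ξ t + k23 ρ f g ξ t|

/-- Assumption A: `f ≤ g` at `t = 0`; `(min_ξ R(ξ,0))·(max_ξ g(ξ,0)²) > −3`;
and the Ricci curvature blows up at the finite time `T`. -/
structure AssumptionA (T : ℝ) (f g ρ : ℝ → ℝ → ℝ) extends WarpedBerger T f g ρ : Prop where
  init_order : ∀ ξ : ℝ, f ξ 0 ≤ g ξ 0
  init_scalar : (⨅ ξ : ℝ, scalR ρ f g ξ 0) * (⨆ ξ : ℝ, (g ξ 0) ^ 2) > -3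
  ricci_blowup : RicciBlowup T f g ρ


lemma aux_second {ρ Q Q1 : ℝ → ℝ} {x q2 : ℝ} (hρ : ∀ y, 0 < ρ y)
    (h1 : ∀ y, HasDerivAt Q (ρ y * Q1 y) y) (h2 : HasDerivAt Q1 (ρ x * q2) x)
    (hmax : ∀ y, Q y ≤ Q x) : Q1 x = 0 ∧ q2 ≤ 0 := by
  have hz : ρ x * Q1 x = 0 := by
    have : IsLocalMax Q x := Filter.Eventually.of_forall hmax
    exact this.hasDerivAt_eq_zero (h1 x)
  have hz1 : Q1 x = 0 := by
    rcases mul_eq_zero.1 hz with h | h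
    · exact absurd h (hρ x).ne'
    · exact h
  refine ⟨hz1, ?_⟩
  by_contra hq
  push Not at hq
  have hpos : 0 < ρ x * q2 := mul_pos (hρ x) hq
  have hev : ∀ᶠ y in 𝓝[>] x, 0 < Q1 y := by
    have h3 := (hasDerivAt_iff_tendsto_slope.1 h2).eventually (lt_mem_nhds hpos)
    have h4 : ∀ᶠ y in 𝓝[>] x, 0 < slope Q1 x y :=
      h3.filter_mono (nhdsWithin_mono x (fun y hy => ne_of_gt hy))
    filter_upwards [h4, self_mem_nhdsWithin] with y hy hxy
    rw [slope_def_field, hz1, sub_zero] at hy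
    have : 0 < y - x := sub_pos.2 hxy
    exact (div_pos_iff_of_pos_right this).1 hy
  obtain ⟨u, hu, hsub⟩ := (mem_nhdsGT_iff_exists_Ioo_subset).1 hev
  have hux : x < u := hu
  set y := (x + u) / 2 with hy
  have hxy : x < y := by rw [hy]; linarith
  have hyu : y < u := by rw [hy]; linarith
  have hmono : StrictMonoOn Q (Icc x y) := by
    apply strictMonoOn_of_deriv_pos (convex_Icc x y)
    · exact fun z _ => (h1 z).continuousAt.continuousWithinAt
    · intro z hz
      rw [interior_Icc] at hz
      rw [(h1 z).deriv]
      exact mul_pos (hρ z) (hsub ⟨hz.1, lt_trans hz.2 hyu⟩)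
  have := hmono (left_mem_Icc.2 hxy.le) (right_mem_Icc.2 hxy.le) hxy
  exact absurd (hmax y) (not_le.2 this)

lemma exists_mem_period {Q : ℝ → ℝ} (hp : ∀ y, Q (y + 2 * π) = Q y) (y : ℝ) :
    ∃ z ∈ Icc (0:ℝ) (2 * π), Q z = Q y := by
  have hp' : Function.Periodic Q (2 * π) := hp
  obtain ⟨z, hz, h⟩ := hp'.exists_mem_Ico₀ (by positivity) y
  exact ⟨z, ⟨hz.1, hz.2.le⟩, h.symm⟩

lemma maxp {a T : ℝ} {ρ Q Q1 Q2 Qt : ℝ → ℝ → ℝ}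
    (hc : ContinuousOn (fun p : ℝ × ℝ => Q p.1 p.2) (univ ×ˢ Ico a T))
    (hper : ∀ y t, Q (y + 2 * π) t = Q y t)
    (h0 : ∀ y, Q y a < 0)
    (hρ : ∀ y t, a < t → t < T → 0 < ρ y t)
    (h1 : ∀ y t, a < t → t < T → HasDerivAt (fun z => Q z t) (ρ y t * Q1 y t) y)
    (h2 : ∀ y t, a < t → t < T → HasDerivAt (fun z => Q1 z t) (ρ y t * Q2 y t) y)
    (ht : ∀ y t, a < t → t < T → HasDerivAt (fun s => Q y s) (Qt y t) t)
    (hneg : ∀ y t, a < t → t < T → Q y t = 0 → Q1 y t = 0 → Q2 y t ≤ 0 → Qt y t < 0) :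
    ∀ y t, a ≤ t → t < T → Q y t < 0 := by
  intro y0 t1 hat1 ht1T
  by_contra hcon
  push Not at hcon
  set K : Set (ℝ × ℝ) := Icc (0:ℝ) (2 * π) ×ˢ Icc a t1 with hK
  have hKc : IsCompact K := isCompact_Icc.prod isCompact_Icc
  have hKs : K ⊆ univ ×ˢ Ico a T := by
    rintro ⟨y, t⟩ ⟨_, h⟩
    exact ⟨trivial, h.1, lt_of_le_of_lt h.2 ht1T⟩
  set S : Set (ℝ × ℝ) := K ∩ (fun p : ℝ × ℝ => Q p.1 p.2) ⁻¹' (Ici 0) with hS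
  have hSc : IsCompact S := by
    apply hKc.of_isClosed_subset _ inter_subset_left
    exact (hc.mono hKs).preimage_isClosed_of_isClosed hKc.isClosed isClosed_Ici
  have hSn : S.Nonempty := by
    obtain ⟨z, hz, h⟩ := exists_mem_period (Q := fun y => Q y t1) (fun y => hper y t1) y0
    refine ⟨(z, t1), ⟨hz, hat1, le_rfl⟩, ?_⟩
    simp only [mem_preimage, mem_Ici]
    have h' : Q z t1 = Q y0 t1 := h
    rw [h']; exact hcon
  obtain ⟨⟨y, t⟩, ⟨⟨hyI, htI⟩, hQ⟩, hmin⟩ := hSc.exists_isMinOn hSn continuous_snd.continuousOn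
  simp only [mem_preimage, mem_Ici] at hQ
  have htI' : a ≤ t ∧ t ≤ t1 := htI
  have htT : t < T := lt_of_le_of_lt htI'.2 ht1T
  have hbefore : ∀ z s, a ≤ s → s < t → Q z s < 0 := by
    intro z s has hst
    by_contra hcs
    push Not at hcs
    obtain ⟨z', hz', h⟩ := exists_mem_period (Q := fun y => Q y s) (fun y => hper y s) z
    have h' : Q z' s = Q z s := h
    have : ((z', s) : ℝ × ℝ) ∈ S := by
      refine ⟨⟨hz', has, (hst.le.trans htI'.2)⟩, ?_⟩
      simp only [mem_preimage, mem_Ici]; rw [h']; exact hcs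
    have := hmin this
    have h7 : t ≤ s := this
    linarith
  have hat : a < t := by
    rcases lt_or_eq_of_le htI'.1 with h | h
    · exact h
    · exfalso; rw [← h] at hQ; linarith [h0 y]
  have hle : ∀ z, Q z t ≤ 0 := by
    intro z
    have hcont : Tendsto (fun s => Q z s) (𝓝[<] t) (𝓝 (Q z t)) :=
      ((ht z t hat htT).continuousAt.tendsto).mono_left nhdsWithin_le_nhds
    apply le_of_tendsto hcont
    filter_upwards [Ioo_mem_nhdsLT hat] with s hs
    exact (hbefore z s hs.1.le hs.2).le
  have hQ0 : Q y t = 0 := le_antisymm (hle y) hQ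
  obtain ⟨hq1, hq2⟩ := aux_second (fun z => hρ z t hat htT) (fun z => h1 z t hat htT)
    (h2 y t hat htT) (fun z => by simpa [hQ0] using hle z)
  have hn := hneg y t hat htT hQ0 hq1 hq2
  have hslope : Tendsto (slope (fun s => Q y s) t) (𝓝[<] t) (𝓝 (Qt y t)) :=
    (hasDerivAt_iff_tendsto_slope.1 (ht y t hat htT)).mono_left
    (nhdsWithin_mono t (fun s hs => ne_of_lt hs))
  have : 0 ≤ Qt y t := by
    apply ge_of_tendsto hslope
    filter_upwards [Ioo_mem_nhdsLT hat] with s hs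
    rw [slope_def_field, hQ0]
    have h5 := hbefore y s hs.1.le hs.2
    have h6 : s - t < 0 := by linarith [hs.2]
    exact div_nonneg_of_nonpos (by simpa using h5.le) h6.le
  linarith


def XX (l : ℝ) : ℝ := Real.exp (2 * l / 3)
def EE (m : ℝ) : ℝ := Real.exp (-2 * m)
def om (X : ℝ) : ℝ := (8 * X - 2 * X ^ 4) / 3
def om1 (X : ℝ) : ℝ := 16 / 9 * (X - X ^ 4)
def om2 (X : ℝ) : ℝ := 32 / 27 * (X - 4 * X ^ 4)
def ze (X : ℝ) : ℝ := 4 * (X - X ^ 4)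
def ze1 (X : ℝ) : ℝ := 8 / 3 * (X - 4 * X ^ 4)

/-- The collection of functions attached to a flow. -/
structure Fl where
  ρ : ℝ → ℝ → ℝ
  m : ℝ → ℝ → ℝ
  l : ℝ → ℝ → ℝ
  n : ℝ → ℝ → ℝ
  x : ℝ → ℝ → ℝ
  k : ℝ → ℝ → ℝ
  x1 : ℝ → ℝ → ℝ
  k1 : ℝ → ℝ → ℝ
  k2 : ℝ → ℝ → ℝ
  x2 : ℝ → ℝ → ℝ

def JC (a b : ℝ) (φ : ℝ → ℝ → ℝ) : Prop :=
  ContinuousOn (fun p : ℝ × ℝ => φ p.1 p.2) (univ ×ˢ Ioo a b)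
def JC0 (a b : ℝ) (φ : ℝ → ℝ → ℝ) : Prop :=
  ContinuousOn (fun p : ℝ × ℝ => φ p.1 p.2) (univ ×ˢ Ico a b)
def Per (φ : ℝ → ℝ → ℝ) : Prop := ∀ y t, φ (y + 2 * π) t = φ y t
def SD (a b : ℝ) (ρ φ ψ : ℝ → ℝ → ℝ) : Prop :=
  ∀ y t, a < t → t < b → HasDerivAt (fun z => φ z t) (ρ y t * ψ y t) y
def TD (a b : ℝ) (φ ψ : ℝ → ℝ → ℝ) : Prop :=
  ∀ y t, a < t → t < b → HasDerivAt (fun s => φ y s) (ψ y t) t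

structure Sys (T : ℝ) (F : Fl) : Prop where
  T_pos : 0 < T
  ρ_pos : ∀ y t, 0 ≤ t → t < T → 0 < F.ρ y t
  per_ρ : Per F.ρ
  per_m : Per F.m
  per_l : Per F.l
  per_n : Per F.n
  per_x : Per F.x
  per_k : Per F.k
  c_ρ : JC0 0 T F.ρ
  c_m : JC0 0 T F.m
  c_l : JC0 0 T F.l
  c_n : JC 0 T F.n
  c_x : JC 0 T F.x
  c_k : JC 0 T F.k
  dm : SD 0 T F.ρ F.m F.n
  dl : SD 0 T F.ρ F.l F.x
  dn : SD 0 T F.ρ F.n F.k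
  dx : SD 0 T F.ρ F.x F.x1
  dk : SD 0 T F.ρ F.k F.k1
  dx1 : SD 0 T F.ρ F.x1 F.x2
  dk1 : SD 0 T F.ρ F.k1 F.k2
  tm : TD 0 T F.m (fun y t => F.k y t + 3 * F.n y t ^ 2 - om (XX (F.l y t)) * EE (F.m y t))
  tl : TD 0 T F.l (fun y t => F.x1 y t + 3 * F.n y t * F.x y t
    + ze (XX (F.l y t)) * EE (F.m y t))
  tn : TD 0 T F.n (fun y t => F.k1 y t + 3 * F.n y t * F.k y t
    - (3 * F.n y t ^ 2 + 2 / 3 * F.x y t ^ 2) * F.n y t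
    + EE (F.m y t) * (2 * om (XX (F.l y t)) * F.n y t - om1 (XX (F.l y t)) * F.x y t))
  tx : TD 0 T F.x (fun y t => F.x2 y t + 3 * F.n y t * F.x1 y t
    - (3 * F.n y t ^ 2 + 2 / 3 * F.x y t ^ 2) * F.x y t
    + EE (F.m y t) * (ze1 (XX (F.l y t)) * F.x y t - 2 * ze (XX (F.l y t)) * F.n y t))
  tk : TD 0 T F.k (fun y t => F.k2 y t + 3 * F.n y t * F.k1 y t
    - 12 * F.n y t ^ 2 * F.k y t - 4 / 3 * F.x y t ^ 2 * F.k y t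
    - 4 / 3 * F.n y t * F.x y t * F.x1 y t
    + EE (F.m y t) * (2 * om (XX (F.l y t)) * F.k y t
      - 4 * om (XX (F.l y t)) * F.n y t ^ 2 + 4 * om1 (XX (F.l y t)) * F.n y t * F.x y t
      - om2 (XX (F.l y t)) * F.x y t ^ 2 - om1 (XX (F.l y t)) * F.x1 y t))
  tρ : TD 0 T F.ρ (fun y t => F.ρ y t * (3 * F.k y t + 3 * F.n y t ^ 2 + 2 / 3 * F.x y t ^ 2))

/-! ### pure algebra -/

lemma alg_n {e n x k k1 P P1 P2 w w1 : ℝ} (he : 0 < e) (hP : 0 < P) (hP1 : 0 ≤ P1)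
    (hw : w ≤ 2)
    (hfin : -4 * P * (P - 1) + 2 * P1 * (1 - P) + P * P2 + 3 / 4 * w1 ^ 2 < 0)
    (h0 : n ^ 2 = P * e ^ 2)
    (h1 : 2 * n * k = (P1 - 2 * P) * e ^ 2 * n)
    (h2 : 2 * (k * k + n * k1) ≤ (P2 - 4 * P1 + 4 * P) * e ^ 2 * n ^ 2 + (P1 - 2 * P) * e ^ 2 * k) :
    2 * n * (k1 + 3 * n * k - (3 * n ^ 2 + 2 / 3 * x ^ 2) * n + e ^ 2 * (2 * w * n - w1 * x))
      < (P1 - 2 * P) * e ^ 2 * (k + 3 * n ^ 2 - w * e ^ 2) := by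
  have hn : n ≠ 0 := by
    rintro rfl
    have : 0 < P * e ^ 2 := by positivity
    rw [← h0] at this; norm_num at this
  have hk : k = (P1 - 2 * P) * e ^ 2 / 2 := by
    have : n * (2 * k - (P1 - 2 * P) * e ^ 2) = 0 := by linarith
    rcases mul_eq_zero.1 this with h | h
    · exact absurd h hn
    · linarith
  obtain ⟨n, rfl⟩ : ∃ n', n = e * n' := ⟨n / e, by field_simp⟩
  obtain ⟨x, rfl⟩ : ∃ n', x = e * n' := ⟨x / e, by field_simp⟩
  obtain ⟨k1, rfl⟩ : ∃ n', k1 = e ^ 3 * n' := ⟨k1 / e ^ 3, by field_simp⟩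
  have h0' : n ^ 2 = P := by
    have : e ^ 2 * (n ^ 2 - P) = 0 := by linarith
    rcases mul_eq_zero.1 this with h | h
    · exact absurd h (by positivity)
    · linarith
  subst hk
  have he4 : 0 < e ^ 4 := by positivity
  have h2' : 2 * n * k1 ≤ (P2 - 4 * P1 + 4 * P) * P := by
    have : e ^ 4 * (2 * n * k1) ≤ e ^ 4 * ((P2 - 4 * P1 + 4 * P) * n ^ 2) := by nlinarith
    rw [h0'] at this
    exact le_of_mul_le_mul_left this he4
  have key : 2 * n * k1 + 3 * P * (P1 - 2 * P) - 6 * P ^ 2 - 4 / 3 * (n * x) ^ 2 + 4 * w * P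
      - 2 * w1 * (n * x)
      < (P1 - 2 * P) * ((P1 - 2 * P) / 2 + 3 * P - w) := by
    nlinarith [sq_nonneg (n * x + 3 / 4 * w1), mul_nonneg hP.le (sub_nonneg.2 hw),
      mul_nonneg hP1 (sub_nonneg.2 hw), sq_nonneg P1]
  have := mul_lt_mul_of_pos_left key he4
  rw [← h0'] at this
  rw [← h0']
  nlinarith

lemma alg_l {E n x x1 k C w z om c0 C0 : ℝ} (hE : 0 < E) (hw : 0 < w) (hC : 0 < C)
    (hom : om ≤ 2) (hp : n ^ 2 ≤ C0 * E) (hz : c0 * (C * w) ≤ z)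
    (hc : 2 * w ^ 2 * C0 + 2 * w < c0)
    (h1 : -x = C * w ^ 2 * n) (h2 : -x1 ≤ C * (2 * w ^ 3) * n ^ 2 + C * w ^ 2 * k) :
    -(x1 + 3 * n * x + z * E) < C * w ^ 2 * (k + 3 * n ^ 2 - om * E) := by
  have hx : x = -(C * w ^ 2 * n) := by linarith
  subst hx
  have a1 : C * (2 * w ^ 3) * n ^ 2 ≤ C * (2 * w ^ 3) * (C0 * E) :=
    mul_le_mul_of_nonneg_left hp (by positivity)
  have a2 : C * w ^ 2 * E * om ≤ C * w ^ 2 * E * 2 :=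
    mul_le_mul_of_nonneg_left hom (by positivity)
  have a3 : c0 * (C * w) * E ≤ z * E := mul_le_mul_of_nonneg_right hz hE.le
  have a4 : (2 * w ^ 2 * C0 + 2 * w) * (C * w * E) < c0 * (C * w * E) :=
    mul_lt_mul_of_pos_right hc (by positivity)
  nlinarith

lemma alg_x {e n x k x1 x2 P P1 P2 w z z1 X4 : ℝ} (he : 0 < e)
    (hz1 : z1 - w = -10 * X4)
    (hfin : n ^ 2 * (P2 - 4 * P1) + e ^ 2 * (-20 * X4 * P + 2 * z ^ 2 + w * P1) < 0)
    (h0 : x ^ 2 = P * e ^ 2)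
    (h1 : 2 * x * x1 = (P1 - 2 * P) * e ^ 2 * n)
    (h2 : 2 * (x1 * x1 + x * x2) ≤
      (P2 - 4 * P1 + 4 * P) * e ^ 2 * n ^ 2 + (P1 - 2 * P) * e ^ 2 * k) :
    2 * x * (x2 + 3 * n * x1 - (3 * n ^ 2 + 2 / 3 * x ^ 2) * x + e ^ 2 * (z1 * x - 2 * z * n))
      < (P1 - 2 * P) * e ^ 2 * (k + 3 * n ^ 2 - w * e ^ 2) := by
  have hz1' : z1 = w - 10 * X4 := by linarith
  subst hz1'
  have he2 : 0 < e ^ 2 := by positivity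
  have a1 := mul_lt_mul_of_pos_left hfin he2
  have a2 : 2 * x * (3 * n * x1) = 3 * n * ((P1 - 2 * P) * e ^ 2 * n) := by rw [← h1]; ring
  have a3 : 0 ≤ 2 * (n * x + e ^ 2 * z) ^ 2 := by positivity
  have a4 : 0 ≤ x ^ 4 := by positivity
  have a5 : x ^ 2 * n ^ 2 = P * e ^ 2 * n ^ 2 := by rw [h0]
  have a6 : x ^ 2 * e ^ 2 * w = P * e ^ 2 * e ^ 2 * w := by rw [h0]
  have a7 : x ^ 2 * e ^ 2 * X4 = P * e ^ 2 * e ^ 2 * X4 := by rw [h0]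
  nlinarith [mul_self_nonneg x1]


lemma alg_k {e n x k x1 k1 k2 x2 P P1 P2 X : ℝ} (he : 0 < e)
    (hfin : ∀ p y, n ^ 2 = p * e ^ 2 → x ^ 2 = y * e ^ 2 →
      -2 * P ^ 2 - 4 * p * P + 4 * p ^ 2 - 2 * om X * p + om X * P1 + (P2 - 4 * P1) * p
      + y * (-(4 / 9) * P + 4 / 9 * p - 4 / 9 * om X - om2 X + 4 / 9 * ze1 X)
      + 2 * p * y + 9 / 8 * om1 X ^ 2 < 0)
    (h0 : k + n ^ 2 + 2 / 9 * x ^ 2 = P * e ^ 2)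
    (h1 : k1 + 2 * n * k + 4 / 9 * x * x1 = (P1 - 2 * P) * e ^ 2 * n)
    (h2 : k2 + 2 * (k * k + n * k1) + 4 / 9 * (x1 * x1 + x * x2) ≤
      (P2 - 4 * P1 + 4 * P) * e ^ 2 * n ^ 2 + (P1 - 2 * P) * e ^ 2 * k) :
    (k2 + 3 * n * k1 - 12 * n ^ 2 * k - 4 / 3 * x ^ 2 * k - 4 / 3 * n * x * x1
    + e ^ 2 * (2 * om X * k - 4 * om X * n ^ 2 + 4 * om1 X * n * x - om2 X * x ^ 2 - om1 X * x1))
    + 2 * n * (k1 + 3 * n * k - (3 * n ^ 2 + 2 / 3 * x ^ 2) * n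
      + e ^ 2 * (2 * om X * n - om1 X * x))
    + 4 / 9 * x * (x2 + 3 * n * x1 - (3 * n ^ 2 + 2 / 3 * x ^ 2) * x
      + e ^ 2 * (ze1 X * x - 2 * ze X * n))
      < (P1 - 2 * P) * e ^ 2 * (k + 3 * n ^ 2 - om X * e ^ 2) := by
  obtain ⟨n, rfl⟩ : ∃ n', n = e * n' := ⟨n / e, by field_simp⟩
  obtain ⟨x, rfl⟩ : ∃ n', x = e * n' := ⟨x / e, by field_simp⟩
  obtain ⟨k, rfl⟩ : ∃ n', k = e ^ 2 * n' := ⟨k / e ^ 2, by field_simp⟩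
  obtain ⟨x1, rfl⟩ : ∃ n', x1 = e ^ 2 * n' := ⟨x1 / e ^ 2, by field_simp⟩
  obtain ⟨k1, rfl⟩ : ∃ n', k1 = e ^ 3 * n' := ⟨k1 / e ^ 3, by field_simp⟩
  obtain ⟨x2, rfl⟩ : ∃ n', x2 = e ^ 3 * n' := ⟨x2 / e ^ 3, by field_simp⟩
  obtain ⟨k2, rfl⟩ : ∃ n', k2 = e ^ 4 * n' := ⟨k2 / e ^ 4, by field_simp⟩
  have hfin' := hfin (n ^ 2) (x ^ 2) (by ring) (by ring)
  have h0' : k = P - n ^ 2 - 2 / 9 * x ^ 2 := by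
    have : e ^ 2 * k = e ^ 2 * (P - n ^ 2 - 2 / 9 * x ^ 2) := by linarith
    exact mul_left_cancel₀ (by positivity) this
  have h1' : k1 = (P1 - 2 * P) * n - 2 * n * k - 4 / 9 * x * x1 := by
    have : e ^ 3 * k1 = e ^ 3 * ((P1 - 2 * P) * n - 2 * n * k - 4 / 9 * x * x1) := by linarith
    exact mul_left_cancel₀ (by positivity) this
  have h2' : k2 + 2 * (k * k + n * k1) + 4 / 9 * (x1 * x1 + x * x2) ≤
      (P2 - 4 * P1 + 4 * P) * n ^ 2 + (P1 - 2 * P) * k := by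
    have : e ^ 4 * (k2 + 2 * (k * k + n * k1) + 4 / 9 * (x1 * x1 + x * x2)) ≤
      e ^ 4 * ((P2 - 4 * P1 + 4 * P) * n ^ 2 + (P1 - 2 * P) * k) := by nlinarith
    exact le_of_mul_le_mul_left this (by positivity)
  have key : (k2 + 3 * n * k1 - 12 * n ^ 2 * k - 4 / 3 * x ^ 2 * k - 4 / 3 * n * x * x1
    + (2 * om X * k - 4 * om X * n ^ 2 + 4 * om1 X * n * x - om2 X * x ^ 2 - om1 X * x1))
    + 2 * n * (k1 + 3 * n * k - (3 * n ^ 2 + 2 / 3 * x ^ 2) * n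
      + (2 * om X * n - om1 X * x))
    + 4 / 9 * x * (x2 + 3 * n * x1 - (3 * n ^ 2 + 2 / 3 * x ^ 2) * x
      + (ze1 X * x - 2 * ze X * n))
      < (P1 - 2 * P) * (k + 3 * n ^ 2 - om X) := by
    have hz : om1 X * n * x * 2 - 8 / 9 * ze X * n * x = 0 := by unfold om1 ze; ring
    have hs : 0 ≤ (2 / 3 * x1 + 3 / 4 * (4 / 3 * n * x + om1 X)) ^ 2 := sq_nonneg _
    have ht : 0 ≤ (4 / 3 * n * x - om1 X) ^ 2 := sq_nonneg _
    subst h1' 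
    subst h0'
    nlinarith only [hz, hs, ht, hfin', h2']
  have he4 : 0 < e ^ 4 := by positivity
  have := mul_lt_mul_of_pos_left key he4
  linarith only [this]


lemma JC.toJC0 {a b t0 : ℝ} {φ : ℝ → ℝ → ℝ} (h : JC a b φ) (h0 : a < t0) : JC0 t0 b φ :=
  ContinuousOn.mono h (fun _ hp => ⟨trivial, lt_of_lt_of_le h0 hp.2.1, hp.2.2⟩)

lemma JC0.toJC0 {a b t0 : ℝ} {φ : ℝ → ℝ → ℝ} (h : JC0 a b φ) (h0 : a ≤ t0) : JC0 t0 b φ :=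
  ContinuousOn.mono h (fun _ hp => ⟨trivial, h0.trans hp.2.1, hp.2.2⟩)

lemma JC0.slice {a b t : ℝ} {φ : ℝ → ℝ → ℝ} (h : JC0 a b φ) (h0 : a ≤ t) (h1 : t < b) :
    Continuous (fun y => φ y t) := by
  have : ContinuousOn (fun y : ℝ => ((y, t) : ℝ × ℝ)) univ := by fun_prop
  have h2 := ContinuousOn.comp h this (fun y _ => ⟨trivial, h0, h1⟩)
  exact continuousOn_univ.1 h2

lemma per_bdd {φ : ℝ → ℝ} (hc : Continuous φ) (hp : ∀ y, φ (y + 2 * π) = φ y) :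
    ∃ C, ∀ y, φ y < C := by
  obtain ⟨z, _, hz⟩ := (isCompact_Icc (a := (0:ℝ)) (b := 2 * π)).exists_isMaxOn
    ⟨0, ⟨le_rfl, by positivity⟩⟩ hc.continuousOn
  refine ⟨φ z + 1, fun y => ?_⟩
  obtain ⟨u, hu, h⟩ := exists_mem_period hp y
  have h2 : φ u ≤ φ z := hz hu
  rw [← h]; linarith

lemma barrier {T t0 A : ℝ} {F : Fl} (S : Sys T F) (ht0 : 0 < t0)
    (hA : ∀ y t, t0 ≤ t → t < T → F.m y t < A)
    {Ψ Ψ1 Ψ2 : ℝ → ℝ} (hΨ : ∀ z < A, HasDerivAt Ψ (Ψ1 z) z)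
    (hΨ1 : ∀ z < A, HasDerivAt Ψ1 (Ψ2 z) z)
    {N N1 N2 Nt : ℝ → ℝ → ℝ} (hN : JC0 t0 T N) (hp : Per N)
    (h0 : ∀ y, N y t0 < Ψ (F.m y t0))
    (d0 : SD t0 T F.ρ N N1) (d1 : SD t0 T F.ρ N1 N2) (dt : TD t0 T N Nt)
    (hneg : ∀ y t, t0 < t → t < T → N y t = Ψ (F.m y t) →
      N1 y t = Ψ1 (F.m y t) * F.n y t →
      N2 y t ≤ Ψ2 (F.m y t) * F.n y t ^ 2 + Ψ1 (F.m y t) * F.k y t →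
      Nt y t < Ψ1 (F.m y t) * (F.k y t + 3 * F.n y t ^ 2
        - om (XX (F.l y t)) * EE (F.m y t))) :
    ∀ y t, t0 ≤ t → t < T → N y t < Ψ (F.m y t) := by
  have main := maxp (a := t0) (T := T) (ρ := F.ρ)
    (Q := fun y t => N y t - Ψ (F.m y t))
    (Q1 := fun y t => N1 y t - Ψ1 (F.m y t) * F.n y t)
    (Q2 := fun y t => N2 y t - (Ψ2 (F.m y t) * F.n y t ^ 2 + Ψ1 (F.m y t) * F.k y t))
    (Qt := fun y t => Nt y t - Ψ1 (F.m y t) * (F.k y t + 3 * F.n y t ^ 2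
        - om (XX (F.l y t)) * EE (F.m y t)))
    ?_ ?_ ?_ ?_ ?_ ?_ ?_ ?_
  · intro y t h1 h2
    have := main y t h1 h2
    linarith
  · have hc : ContinuousOn Ψ (Iio A) := fun z hz => (hΨ z hz).continuousAt.continuousWithinAt
    have hm := S.c_m.toJC0 ht0.le
    exact ContinuousOn.sub hN (ContinuousOn.comp hc hm (fun p hp => hA _ _ hp.2.1 hp.2.2))
  · intro y t
    simp only [hp y t, S.per_m y t]
  · intro y
    have := h0 y
    linarith
  · intro y t h1 h2
    exact S.ρ_pos y t (by linarith) h2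
  · intro y t h1 h2
    have e1 := (hΨ _ (hA y t h1.le h2)).comp y (S.dm y t (by linarith) h2)
    refine ((d0 y t h1 h2).sub e1).congr_deriv ?_
    ring
  · intro y t h1 h2
    have e1 := (hΨ1 _ (hA y t h1.le h2)).comp y (S.dm y t (by linarith) h2)
    have e2 := e1.mul (S.dn y t (by linarith) h2)
    refine ((d1 y t h1 h2).sub e2).congr_deriv ?_
    simp only [Function.comp]; ring
  · intro y t h1 h2
    have e1 := (hΨ _ (hA y t h1.le h2)).comp t (S.tm y t (by linarith) h2)
    exact (dt y t h1 h2).sub e1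
  · intro y t h1 h2 q0 q1 q2
    have := hneg y t h1 h2 (by linarith) (by linarith) (by linarith)
    linarith

lemma EE_pos (m : ℝ) : 0 < EE m := Real.exp_pos _
lemma EE_sq (m : ℝ) : EE m = Real.exp (-m) ^ 2 := by
  unfold EE; rw [← Real.exp_nat_mul]; congr 1; push_cast; ring

lemma EE_der (m : ℝ) : HasDerivAt EE (-2 * EE m) m := by
  have : HasDerivAt (fun z : ℝ => -2 * z) (-2) m := by
    simpa using (hasDerivAt_id m).const_mul (-2:ℝ)
  have h := this.exp
  refine h.congr_deriv ?_
  unfold EE; ring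

/-- barrier of the form `Φ(m) E` -/
lemma barrierE {T t0 A : ℝ} {F : Fl} (S : Sys T F) (ht0 : 0 < t0)
    (hA : ∀ y t, t0 ≤ t → t < T → F.m y t < A)
    {P P1 P2 : ℝ → ℝ} (hP : ∀ z < A, HasDerivAt P (P1 z) z)
    (hP1 : ∀ z < A, HasDerivAt P1 (P2 z) z)
    {N N1 N2 Nt : ℝ → ℝ → ℝ} (hN : JC0 t0 T N) (hp : Per N)
    (h0 : ∀ y, N y t0 < P (F.m y t0) * EE (F.m y t0))
    (d0 : SD t0 T F.ρ N N1) (d1 : SD t0 T F.ρ N1 N2) (dt : TD t0 T N Nt)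
    (hneg : ∀ y t e, t0 < t → t < T → 0 < e → EE (F.m y t) = e ^ 2 →
      N y t = P (F.m y t) * e ^ 2 →
      N1 y t = (P1 (F.m y t) - 2 * P (F.m y t)) * e ^ 2 * F.n y t →
      N2 y t ≤ (P2 (F.m y t) - 4 * P1 (F.m y t) + 4 * P (F.m y t)) * e ^ 2 * F.n y t ^ 2
        + (P1 (F.m y t) - 2 * P (F.m y t)) * e ^ 2 * F.k y t →
      Nt y t < (P1 (F.m y t) - 2 * P (F.m y t)) * e ^ 2 * (F.k y t + 3 * F.n y t ^ 2
        - om (XX (F.l y t)) * e ^ 2)) :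
    ∀ y t, t0 ≤ t → t < T → N y t < P (F.m y t) * EE (F.m y t) := by
  refine barrier S ht0 hA (Ψ := fun z => P z * EE z) (Ψ1 := fun z => (P1 z - 2 * P z) * EE z)
    (Ψ2 := fun z => (P2 z - 4 * P1 z + 4 * P z) * EE z) ?_ ?_ hN hp h0 d0 d1 dt ?_
  · intro z hz
    refine ((hP z hz).mul (EE_der z)).congr_deriv ?_
    ring
  · intro z hz
    refine (((hP1 z hz).sub ((hP z hz).const_mul 2)).mul (EE_der z)).congr_deriv ?_
    simp only [Pi.sub_apply]; ring
  · intro y t h1 h2 q0 q1 q2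
    have := hneg y t (Real.exp (-F.m y t)) h1 h2 (Real.exp_pos _) (EE_sq _)
    rw [← EE_sq] at this
    exact this q0 q1 q2

lemma XX_pos (l : ℝ) : 0 < XX l := Real.exp_pos _
lemma XX_le {l : ℝ} (h : l ≤ 0) : XX l ≤ 1 := by
  unfold XX; exact Real.exp_le_one_iff.2 (by linarith)
lemma XX_lt {l : ℝ} (h : l < 0) : XX l < 1 := by
  unfold XX; exact Real.exp_lt_one_iff.2 (by linarith)
lemma XX_cube (l : ℝ) : XX l ^ 3 = Real.exp (2 * l) := by
  unfold XX; rw [← Real.exp_nat_mul]; congr 1; push_cast; ring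
lemma om_le {X : ℝ} (h : 0 < X) : om X ≤ 2 := by
  unfold om
  nlinarith [mul_nonneg (sq_nonneg (1 - X)) (by positivity : 0 ≤ 3 + 2 * X + X ^ 2)]
lemma om_pos {X : ℝ} (h : 0 < X) (h1 : X ≤ 1) : 0 < om X := by
  unfold om
  have : X ^ 3 ≤ 1 := pow_le_one₀ h.le h1
  nlinarith
lemma om_ge {l : ℝ} (h : l ≤ 0) : 2 - om (XX l) ≤ 16 / 9 * l ^ 2 := by
  have hX := XX_pos l
  have h1 := XX_le h
  have h2 : 1 - XX l ≤ -(2 * l / 3) := by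
    have := Real.add_one_le_exp (2 * l / 3); unfold XX; linarith
  have h3 : (1 - XX l) ^ 2 ≤ (-(2 * l / 3)) ^ 2 := pow_le_pow_left₀ (by linarith) h2 2
  have h4 : 2 - om (XX l) = 2 / 3 * ((1 - XX l) ^ 2 * (3 + 2 * XX l + XX l ^ 2)) := by
    unfold om; ring
  have h5 : (1 - XX l) ^ 2 * (3 + 2 * XX l + XX l ^ 2) ≤ (1 - XX l) ^ 2 * 6 := by
    apply mul_le_mul_of_nonneg_left _ (sq_nonneg _); nlinarith
  nlinarith
lemma D_nonneg {l : ℝ} (h : l ≤ 0) : 0 ≤ XX l - XX l ^ 4 := by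
  have := pow_le_one₀ (n := 3) (XX_pos l).le (XX_le h)
  nlinarith [XX_pos l]
lemma D_le {l : ℝ} (h : l ≤ 0) : XX l - XX l ^ 4 ≤ -(2 * l) := by
  have h1 := XX_cube l
  have h2 := Real.add_one_le_exp (2 * l)
  have h3 : XX l - XX l ^ 4 = XX l * (1 - XX l ^ 3) := by ring
  have h4 : 0 ≤ 1 - XX l ^ 3 := sub_nonneg.2 (pow_le_one₀ (XX_pos l).le (XX_le h))
  have := mul_le_mul_of_nonneg_right (XX_le h) h4
  rw [h3]; rw [h1] at *; linarith
lemma ze_ge {L : ℝ} (hL : 0 < L) : ∃ c0, 0 < c0 ∧ ∀ l, -L ≤ l → l ≤ 0 → c0 * (-l) ≤ ze (XX l) := by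
  refine ⟨8 * XX (-L) / (1 + 2 * L), by have := XX_pos (-L); positivity, fun l h1 h2 => ?_⟩
  have hX : XX (-L) ≤ XX l := by unfold XX; exact Real.exp_le_exp.2 (by linarith)
  have h3 : 1 - XX l ^ 3 ≥ -(2 * l) / (1 + 2 * L) := by
    rw [XX_cube]
    have h5 : Real.exp (2 * l) ≤ 1 / (1 - 2 * l) := by
      have := Real.add_one_le_exp (-(2 * l))
      rw [Real.exp_neg] at this
      have hp := Real.exp_pos (2 * l)
      rw [le_div_iff₀ (by linarith)]
      calc Real.exp (2 * l) * (1 - 2 * l) ≤ Real.exp (2 * l) * (Real.exp (2 * l))⁻¹ :=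
            mul_le_mul_of_nonneg_left (by linarith) hp.le
        _ = 1 := mul_inv_cancel₀ hp.ne'
    have h6 : -(2 * l) / (1 + 2 * L) ≤ -(2 * l) / (1 - 2 * l) :=
      div_le_div_of_nonneg_left (by linarith) (by linarith) (by linarith)
    have h7 : 1 - 1 / (1 - 2 * l) = -(2 * l) / (1 - 2 * l) := by
      have : (1 - 2 * l) ≠ 0 := by linarith
      field_simp; ring
    linarith
  have h4 : ze (XX l) = 4 * (XX l * (1 - XX l ^ 3)) := by unfold ze; ring
  rw [h4]
  have h8 : XX (-L) * (-(2 * l) / (1 + 2 * L)) ≤ XX l * (1 - XX l ^ 3) :=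
    mul_le_mul hX h3 (div_nonneg (by linarith) (by linarith)) (XX_pos l).le
  calc 8 * XX (-L) / (1 + 2 * L) * (-l) = 4 * (XX (-L) * (-(2 * l) / (1 + 2 * L))) := by
        field_simp; ring
    _ ≤ _ := by linarith


lemma est_l0 {T : ℝ} {F : Fl} (S : Sys T F) (hl : ∀ y, F.l y 0 ≤ 0) :
    ∀ y t, 0 ≤ t → t < T → F.l y t ≤ 0 := by
  intro y t h1 h2
  apply le_of_forall_pos_le_add
  intro ε hε
  have main := maxp (a := 0) (T := T) (ρ := F.ρ) (Q := fun y t => F.l y t - ε)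
    (Q1 := F.x) (Q2 := F.x1) (Qt := fun y t => F.x1 y t + 3 * F.n y t * F.x y t
    + ze (XX (F.l y t)) * EE (F.m y t)) ?_ ?_ ?_ ?_ ?_ S.dx ?_ ?_
  · have := main y t h1 h2
    linarith
  · exact ContinuousOn.sub S.c_l continuousOn_const
  · intro y t; simp only [S.per_l y t]
  · intro y; have := hl y; linarith
  · intro y t h1 h2; exact S.ρ_pos y t h1.le h2
  · intro y t h1 h2; exact (S.dl y t h1 h2).sub_const ε
  · intro y t h1 h2; exact (S.tl y t h1 h2).sub_const ε
  · intro y t h1 h2 q0 q1 q2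
    have hl : F.l y t = ε := by linarith
    have hX : 1 < XX (F.l y t) := by
      unfold XX; rw [hl]; exact Real.one_lt_exp_iff.2 (by linarith)
    have hz : ze (XX (F.l y t)) < 0 := by
      unfold ze
      have : 1 < XX (F.l y t) ^ 3 := one_lt_pow₀ hX (by norm_num)
      nlinarith
    have := mul_neg_of_neg_of_pos hz (EE_pos (F.m y t))
    rw [q1]
    linarith

lemma est_m {T t0 : ℝ} {F : Fl} (S : Sys T F) (ht0 : 0 < t0) (ht0T : t0 < T)
    (hl : ∀ y t, 0 ≤ t → t < T → F.l y t ≤ 0) :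
    ∃ M1, ∀ y t, t0 ≤ t → t < T → F.m y t < M1 := by
  obtain ⟨M1, hM1⟩ := per_bdd (S.c_m.slice ht0.le ht0T) (fun y => S.per_m y t0)
  refine ⟨M1, ?_⟩
  have main := maxp (a := t0) (T := T) (ρ := F.ρ) (Q := fun y t => F.m y t - M1)
    (Q1 := F.n) (Q2 := F.k) (Qt := fun y t => F.k y t + 3 * F.n y t ^ 2
      - om (XX (F.l y t)) * EE (F.m y t)) ?_ ?_ ?_ ?_ ?_ ?_ ?_ ?_
  · intro y t h1 h2
    have := main y t h1 h2
    linarith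
  · exact ContinuousOn.sub (S.c_m.toJC0 ht0.le) continuousOn_const
  · intro y t; simp only [S.per_m y t]
  · intro y; have := hM1 y; linarith
  · intro y t h1 h2; exact S.ρ_pos y t (by linarith) h2
  · intro y t h1 h2; exact (S.dm y t (by linarith) h2).sub_const M1
  · intro y t h1 h2; exact (S.dn y t (by linarith) h2)
  · intro y t h1 h2; exact (S.tm y t (by linarith) h2).sub_const M1
  · intro y t h1 h2 q0 q1 q2
    have hl' := hl y t (by linarith) h2
    have := mul_pos (om_pos (XX_pos _) (XX_le hl')) (EE_pos (F.m y t))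
    rw [q1]
    linarith

lemma est_L {T t0 : ℝ} {F : Fl} (S : Sys T F) (ht0 : 0 < t0) (ht0T : t0 < T) :
    ∃ L, 0 < L ∧ ∀ y t, t0 ≤ t → t < T → -L < F.l y t := by
  obtain ⟨L0, hL0⟩ := per_bdd (φ := fun y => -F.l y t0) (S.c_l.slice ht0.le ht0T).neg
    (fun y => by simp only [S.per_l y t0])
  refine ⟨max L0 1, by positivity, ?_⟩
  set L := max L0 1
  have hLp : 0 < L := by positivity
  have main := maxp (a := t0) (T := T) (ρ := F.ρ) (Q := fun y t => -F.l y t - L)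
    (Q1 := fun y t => -F.x y t) (Q2 := fun y t => -F.x1 y t)
    (Qt := fun y t => -(F.x1 y t + 3 * F.n y t * F.x y t
    + ze (XX (F.l y t)) * EE (F.m y t))) ?_ ?_ ?_ ?_ ?_ ?_ ?_ ?_
  · intro y t h1 h2
    have := main y t h1 h2
    linarith
  · exact ContinuousOn.sub (S.c_l.toJC0 ht0.le).neg continuousOn_const
  · intro y t; simp only [S.per_l y t]
  · intro y; have := hL0 y; have := le_max_left L0 1; linarith
  · intro y t h1 h2; exact S.ρ_pos y t (by linarith) h2
  · intro y t h1 h2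
    exact ((S.dl y t (by linarith) h2).neg.sub_const L).congr_deriv (by ring)
  · intro y t h1 h2; exact (S.dx y t (by linarith) h2).neg.congr_deriv (by ring)
  · intro y t h1 h2; exact (S.tl y t (by linarith) h2).neg.sub_const L
  · intro y t h1 h2 q0 q1 q2
    have hl : F.l y t = -L := by linarith
    have hX : XX (F.l y t) < 1 := XX_lt (by linarith)
    have hz : 0 < ze (XX (F.l y t)) := by
      unfold ze
      have : XX (F.l y t) ^ 3 < 1 := pow_lt_one₀ (XX_pos _).le hX (by norm_num)
      nlinarith [XX_pos (F.l y t)]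
    have := mul_pos hz (EE_pos (F.m y t))
    have hx : F.x y t = 0 := by linarith
    rw [hx]
    linarith

/-- generic gradient barrier -/
lemma est_n {T t0 A : ℝ} {F : Fl} (S : Sys T F) (ht0 : 0 < t0)
    (hl : ∀ y t, 0 ≤ t → t < T → F.l y t ≤ 0)
    (hA : ∀ y t, t0 ≤ t → t < T → F.m y t < A)
    {P P1 P2 : ℝ → ℝ} (hP : ∀ z < A, HasDerivAt P (P1 z) z)
    (hP1 : ∀ z < A, HasDerivAt P1 (P2 z) z)
    (h0 : ∀ y, F.n y t0 ^ 2 < P (F.m y t0) * EE (F.m y t0))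
    (hpos : ∀ z < A, 0 < P z) (hpos1 : ∀ z < A, 0 ≤ P1 z)
    (hfin : ∀ y t, t0 < t → t < T → -4 * P (F.m y t) * (P (F.m y t) - 1)
      + 2 * P1 (F.m y t) * (1 - P (F.m y t)) + P (F.m y t) * P2 (F.m y t)
      + 3 / 4 * om1 (XX (F.l y t)) ^ 2 < 0) :
    ∀ y t, t0 ≤ t → t < T → F.n y t ^ 2 < P (F.m y t) * EE (F.m y t) := by
  refine barrierE S ht0 hA hP hP1 (N := fun y t => F.n y t ^ 2)
    (N1 := fun y t => 2 * F.n y t * F.k y t)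
    (N2 := fun y t => 2 * (F.k y t * F.k y t + F.n y t * F.k1 y t))
    (Nt := fun y t => 2 * F.n y t * (F.k1 y t + 3 * F.n y t * F.k y t
    - (3 * F.n y t ^ 2 + 2 / 3 * F.x y t ^ 2) * F.n y t
    + EE (F.m y t) * (2 * om (XX (F.l y t)) * F.n y t - om1 (XX (F.l y t)) * F.x y t)))
    ?_ ?_ h0 ?_ ?_ ?_ ?_
  · exact ContinuousOn.pow (S.c_n.toJC0 ht0) 2
  · intro y t; simp only [S.per_n y t]
  · intro y t h1 h2
    refine ((S.dn y t (by linarith) h2).pow 2).congr_deriv (by simp; ring)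
  · intro y t h1 h2
    refine (((S.dn y t (by linarith) h2).const_mul 2).mul
      (S.dk y t (by linarith) h2)).congr_deriv (by ring)
  · intro y t h1 h2
    refine ((S.tn y t (by linarith) h2).pow 2).congr_deriv (by simp)
  · intro y t e h1 h2 he hE q0 q1 q2
    have hlt := hA y t h1.le h2
    have hl' := hl y t (by linarith) h2
    simp only [hE]
    exact alg_n he (hpos _ hlt) (hpos1 _ hlt) (om_le (XX_pos _)) (hfin y t h1 h2) q0 q1 q2

def wf (A z : ℝ) : ℝ := (A - z)⁻¹

lemma wf_pos {A z : ℝ} (h : z < A) : 0 < wf A z := inv_pos.2 (by linarith)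
lemma wf_der {A z : ℝ} (h : z < A) : HasDerivAt (wf A) (wf A z ^ 2) z := by
  have h1 : HasDerivAt (fun z => A - z) (-1) z := by
    simpa using (hasDerivAt_id z).const_sub A
  have := h1.inv (by linarith : A - z ≠ 0)
  refine this.congr_deriv ?_
  unfold wf; field_simp
lemma wf_der2 {A z : ℝ} (h : z < A) : HasDerivAt (fun z => wf A z ^ 2) (2 * wf A z ^ 3) z := by
  refine ((wf_der h).pow 2).congr_deriv ?_
  simp; ring
lemma wf_der3 {A z : ℝ} (h : z < A) : HasDerivAt (fun z => wf A z ^ 3) (3 * wf A z ^ 4) z := by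
  refine ((wf_der h).pow 3).congr_deriv ?_
  simp; ring


lemma one_div_EE (m : ℝ) : EE m * Real.exp (2 * m) = 1 := by
  unfold EE; rw [← Real.exp_add]; simp

/-- constant bound for `n^2 e^{2m}` -/
lemma est_C0 {T t0 A : ℝ} {F : Fl} (S : Sys T F) (ht0 : 0 < t0) (ht0T : t0 < T)
    (hl : ∀ y t, 0 ≤ t → t < T → F.l y t ≤ 0)
    (hA : ∀ y t, t0 ≤ t → t < T → F.m y t < A) :
    ∃ C0, 2 ≤ C0 ∧ ∀ y t, t0 ≤ t → t < T → F.n y t ^ 2 < C0 * EE (F.m y t) := by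
  have hcn := (S.c_n.toJC0 ht0).slice le_rfl ht0T
  have hcm := (S.c_m).slice ht0.le ht0T
  obtain ⟨C, hC⟩ := per_bdd (φ := fun y => F.n y t0 ^ 2 * Real.exp (2 * F.m y t0))
    ((hcn.pow 2).mul (Real.continuous_exp.comp (continuous_const.mul hcm)))
    (fun y => by simp only [S.per_n y t0, S.per_m y t0])
  refine ⟨max C 2, le_max_right _ _, ?_⟩
  have h2 : 2 ≤ max C 2 := le_max_right _ _
  refine est_n S ht0 hl hA (P := fun _ => max C 2) (P1 := fun _ => 0) (P2 := fun _ => 0)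
    (fun z _ => hasDerivAt_const z _) (fun z _ => hasDerivAt_const z _) ?_
    (fun z _ => by linarith) (fun z _ => le_rfl) ?_
  · intro y
    have h3 : F.n y t0 ^ 2 * Real.exp (2 * F.m y t0) < max C 2 :=
      lt_of_lt_of_le (hC y) (le_max_left _ _)
    have h4 := mul_lt_mul_of_pos_right h3 (EE_pos (F.m y t0))
    have h5 := one_div_EE (F.m y t0)
    calc F.n y t0 ^ 2 = F.n y t0 ^ 2 * Real.exp (2 * F.m y t0) * EE (F.m y t0) := by
          rw [mul_assoc, mul_comm (Real.exp _), h5, mul_one]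
      _ < _ := h4
  · intro y t h1 h2'
    have hl' := hl y t (by linarith) h2'
    have hD := D_nonneg hl'
    have hD1 : XX (F.l y t) - XX (F.l y t) ^ 4 ≤ 1 := by
      have := XX_le hl'
      have := pow_pos (XX_pos (F.l y t)) 4
      linarith
    have hD2 : (XX (F.l y t) - XX (F.l y t) ^ 4) ^ 2 ≤ 1 := pow_le_one₀ hD hD1
    unfold om1
    nlinarith

lemma est_w1 {T t0 A c0 C0 : ℝ} {F : Fl} (S : Sys T F) (ht0 : 0 < t0) (ht0T : t0 < T)
    (hA : ∀ y t, t0 ≤ t → t < T → F.m y t < A)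
    (hn : ∀ y t, t0 ≤ t → t < T → F.n y t ^ 2 < C0 * EE (F.m y t))
    (hz : ∀ y t, t0 ≤ t → t < T → c0 * (-F.l y t) ≤ ze (XX (F.l y t)))
    (hw : ∀ y t, t0 ≤ t → t < T →
      2 * wf A (F.m y t) ^ 2 * C0 + 2 * wf A (F.m y t) < c0) :
    ∃ C1, 1 ≤ C1 ∧ ∀ y t, t0 ≤ t → t < T → -F.l y t < C1 * wf A (F.m y t) := by
  have hcl := (S.c_l).slice ht0.le ht0T
  have hcm := (S.c_m).slice ht0.le ht0T
  obtain ⟨C, hC⟩ := per_bdd (φ := fun y => -F.l y t0 * (A - F.m y t0))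
    (hcl.neg.mul (continuous_const.sub hcm))
    (fun y => by simp only [S.per_l y t0, S.per_m y t0])
  refine ⟨max C 1, le_max_right _ _, ?_⟩
  set C1 := max C 1
  have hC1 : 1 ≤ C1 := le_max_right _ _
  refine barrier S ht0 hA (Ψ := fun z => C1 * wf A z) (Ψ1 := fun z => C1 * wf A z ^ 2)
    (Ψ2 := fun z => C1 * (2 * wf A z ^ 3)) (fun z h => (wf_der h).const_mul _)
    (fun z h => (wf_der2 h).const_mul _)
    (N := fun y t => -F.l y t) (N1 := fun y t => -F.x y t) (N2 := fun y t => -F.x1 y t)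
    (Nt := fun y t => -(F.x1 y t + 3 * F.n y t * F.x y t
    + ze (XX (F.l y t)) * EE (F.m y t))) ?_ ?_ ?_ ?_ ?_ ?_ ?_
  · exact ContinuousOn.neg (S.c_l.toJC0 ht0.le)
  · intro y t; simp only [S.per_l y t]
  · intro y
    have h3 := lt_of_lt_of_le (hC y) (le_max_left C 1)
    have h4 : 0 < A - F.m y t0 := by linarith [hA y t0 le_rfl ht0T]
    change -F.l y t0 < C1 * (A - F.m y t0)⁻¹
    rw [← div_eq_mul_inv, lt_div_iff₀ h4]
    exact h3
  · intro y t h1 h2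
    exact ((S.dl y t (by linarith) h2).neg).congr_deriv (by ring)
  · intro y t h1 h2; exact (S.dx y t (by linarith) h2).neg.congr_deriv (by ring)
  · intro y t h1 h2; exact (S.tl y t (by linarith) h2).neg
  · intro y t h1 h2 q0 q1 q2
    have hz' := hz y t h1.le h2
    rw [q0] at hz'
    exact alg_l (EE_pos _) (wf_pos (hA y t h1.le h2)) (by linarith) (om_le (XX_pos _))
      (hn y t h1.le h2).le hz' (hw y t h1.le h2) q1 q2

lemma est_w2 {T t0 A C0 C1 X0 : ℝ} {F : Fl} (S : Sys T F) (ht0 : 0 < t0) (ht0T : t0 < T)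
    (hl : ∀ y t, 0 ≤ t → t < T → F.l y t ≤ 0)
    (hA : ∀ y t, t0 ≤ t → t < T → F.m y t < A)
    (hn : ∀ y t, t0 ≤ t → t < T → F.n y t ^ 2 < C0 * EE (F.m y t))
    (hX0 : 0 < X0) (hX : ∀ y t, t0 ≤ t → t < T → X0 ≤ XX (F.l y t) ^ 4)
    (hlw : ∀ y t, t0 ≤ t → t < T → -F.l y t < C1 * wf A (F.m y t))
    (hw1 : ∀ y t, t0 ≤ t → t < T → wf A (F.m y t) ≤ X0)
    (hw2 : ∀ y t, t0 ≤ t → t < T → C0 * wf A (F.m y t) ≤ 1) :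
    ∃ C2, 1 ≤ C2 ∧ ∀ y t, t0 ≤ t → t < T →
      F.x y t ^ 2 < C2 * wf A (F.m y t) ^ 2 * EE (F.m y t) := by
  have hcx := (S.c_x.toJC0 ht0).slice le_rfl ht0T
  have hcm := (S.c_m).slice ht0.le ht0T
  obtain ⟨C, hC⟩ := per_bdd
    (φ := fun y => F.x y t0 ^ 2 * Real.exp (2 * F.m y t0) * (A - F.m y t0) ^ 2)
    (((hcx.pow 2).mul (Real.continuous_exp.comp (continuous_const.mul hcm))).mul
      ((continuous_const.sub hcm).pow 2))
    (fun y => by simp only [S.per_x y t0, S.per_m y t0])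
  refine ⟨max (max C 1) (20 * C1 ^ 2 / X0), (le_max_right _ _).trans (le_max_left _ _), ?_⟩
  set C2 := max (max C 1) (20 * C1 ^ 2 / X0)
  have hC2 : 1 ≤ C2 := (le_max_right _ _).trans (le_max_left _ _)
  have hC2' : C ≤ C2 := (le_max_left _ _).trans (le_max_left _ _)
  have hC2'' : 20 * C1 ^ 2 ≤ C2 * X0 := by
    have : 20 * C1 ^ 2 / X0 ≤ C2 := le_max_right _ _
    rwa [div_le_iff₀ hX0] at this
  refine barrierE S ht0 hA (P := fun z => C2 * wf A z ^ 2)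
    (P1 := fun z => C2 * (2 * wf A z ^ 3)) (P2 := fun z => C2 * (2 * (3 * wf A z ^ 4)))
    (fun z h => (wf_der2 h).const_mul _)
    (fun z h => ((wf_der3 h).const_mul _).const_mul _)
    (N := fun y t => F.x y t ^ 2) (N1 := fun y t => 2 * F.x y t * F.x1 y t)
    (N2 := fun y t => 2 * (F.x1 y t * F.x1 y t + F.x y t * F.x2 y t))
    (Nt := fun y t => 2 * F.x y t * (F.x2 y t + 3 * F.n y t * F.x1 y t
    - (3 * F.n y t ^ 2 + 2 / 3 * F.x y t ^ 2) * F.x y t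
    + EE (F.m y t) * (ze1 (XX (F.l y t)) * F.x y t - 2 * ze (XX (F.l y t)) * F.n y t)))
    ?_ ?_ ?_ ?_ ?_ ?_ ?_
  · exact ContinuousOn.pow (S.c_x.toJC0 ht0) 2
  · intro y t; simp only [S.per_x y t]
  · intro y
    have h3 := lt_of_lt_of_le (hC y) hC2'
    have h4 : 0 < A - F.m y t0 := by linarith [hA y t0 le_rfl ht0T]
    have h5 := one_div_EE (F.m y t0)
    have h6 : F.x y t0 ^ 2 * Real.exp (2 * F.m y t0) < C2 * wf A (F.m y t0) ^ 2 := by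
      unfold wf
      rw [inv_pow, ← div_eq_mul_inv, lt_div_iff₀ (by positivity)]
      exact h3
    calc F.x y t0 ^ 2 = F.x y t0 ^ 2 * Real.exp (2 * F.m y t0) * EE (F.m y t0) := by
          rw [mul_assoc, mul_comm (Real.exp _), h5, mul_one]
      _ < _ := mul_lt_mul_of_pos_right h6 (EE_pos _)
  · intro y t h1 h2
    refine ((S.dx y t (by linarith) h2).pow 2).congr_deriv (by simp; ring)
  · intro y t h1 h2
    refine (((S.dx y t (by linarith) h2).const_mul 2).mul
      (S.dx1 y t (by linarith) h2)).congr_deriv (by ring)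
  · intro y t h1 h2
    refine ((S.tx y t (by linarith) h2).pow 2).congr_deriv (by simp)
  · intro y t e h1 h2 he hE q0 q1 q2
    have hl' := hl y t (by linarith) h2
    have hn' := hn y t h1.le h2
    simp only [hE] at hn' ⊢
    refine alg_x (X4 := XX (F.l y t) ^ 4) he (by unfold ze1 om; ring) ?_ q0 q1 q2
    have hD := D_nonneg hl'
    have hD1 := D_le hl'
    have hlw' := hlw y t h1.le h2
    have hX' := hX y t h1.le h2
    have hw1' := hw1 y t h1.le h2
    have hw2' := hw2 y t h1.le h2
    have hwp := wf_pos (hA y t h1.le h2)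
    have hom := om_le (XX_pos (F.l y t))
    set w := wf A (F.m y t)
    set X4 := XX (F.l y t) ^ 4
    have he2 : 0 < e ^ 2 := by positivity
    have hC2p : 0 < C2 := by linarith
    have hG : 0 < C2 * X0 * w ^ 2 := by positivity
    have b1 : F.n y t ^ 2 * (C2 * (2 * (3 * w ^ 4)) - 4 * (C2 * (2 * w ^ 3)))
        ≤ e ^ 2 * (6 * (C2 * X0 * w ^ 2)) := by
      have c1 : F.n y t ^ 2 * (C2 * (2 * (3 * w ^ 4))) ≤ C0 * e ^ 2 * (C2 * (2 * (3 * w ^ 4))) :=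
        mul_le_mul_of_nonneg_right hn'.le (by positivity)
      have c2 : C0 * w * (6 * C2 * w ^ 3 * e ^ 2) ≤ 1 * (6 * C2 * w ^ 3 * e ^ 2) :=
        mul_le_mul_of_nonneg_right hw2' (by positivity)
      have c3 : w * (6 * C2 * w ^ 2 * e ^ 2) ≤ X0 * (6 * C2 * w ^ 2 * e ^ 2) :=
        mul_le_mul_of_nonneg_right hw1' (by positivity)
      have c4 : 0 ≤ F.n y t ^ 2 * (4 * (C2 * (2 * w ^ 3))) := by positivity
      nlinarith
    have b2 : om (XX (F.l y t)) * (C2 * (2 * w ^ 3)) ≤ 4 * (C2 * X0 * w ^ 2) := by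
      have c1 : om (XX (F.l y t)) * (C2 * (2 * w ^ 3)) ≤ 2 * (C2 * (2 * w ^ 3)) :=
        mul_le_mul_of_nonneg_right hom (by positivity)
      have c3 : w * (4 * C2 * w ^ 2) ≤ X0 * (4 * C2 * w ^ 2) :=
        mul_le_mul_of_nonneg_right hw1' (by positivity)
      nlinarith
    have b3 : 2 * ze (XX (F.l y t)) ^ 2 ≤ 32 / 5 * (C2 * X0 * w ^ 2) := by
      have c1 : (XX (F.l y t) - XX (F.l y t) ^ 4) ^ 2 ≤ (2 * (C1 * w)) ^ 2 :=
        pow_le_pow_left₀ hD (by linarith) 2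
      have c2 : 20 * C1 ^ 2 * w ^ 2 ≤ C2 * X0 * w ^ 2 :=
        mul_le_mul_of_nonneg_right hC2'' (by positivity)
      unfold ze
      nlinarith
    have b4 : -20 * X4 * (C2 * w ^ 2) ≤ -20 * (C2 * X0 * w ^ 2) := by
      have := mul_le_mul_of_nonneg_right hX' (by positivity : 0 ≤ C2 * w ^ 2)
      linarith
    have b5 : e ^ 2 * (-20 * X4 * (C2 * w ^ 2) + 2 * ze (XX (F.l y t)) ^ 2
        + om (XX (F.l y t)) * (C2 * (2 * w ^ 3))) ≤ e ^ 2 * (-(48/5) * (C2 * X0 * w ^ 2)) :=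
      mul_le_mul_of_nonneg_left (by linarith) he2.le
    have b6 : 0 < e ^ 2 * (C2 * X0 * w ^ 2) := by positivity
    linarith

lemma fin4 {B w C1 D l : ℝ} (hBC : 15 * C1 ^ 2 + 2 ≤ B) (hB2 : 2 ≤ B)
    (hD : 0 ≤ D) (hD1 : D ≤ -(2 * l)) (hlw' : -l < C1 * w) (hw1' : w ≤ 1)
    (hwp : 0 < w) :
    -4 * (1 + B * w) * (1 + B * w - 1) + 2 * (B * w ^ 2) * (1 - (1 + B * w))
      + (1 + B * w) * (B * (2 * w ^ 3)) + 3 / 4 * (16 / 9 * D) ^ 2 < 0 := by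
  have c1 : (D) ^ 2 ≤ (2 * (C1 * w)) ^ 2 :=
      pow_le_pow_left₀ hD (by linarith) 2
  have c2 : w ^ 2 ≤ 1 := pow_le_one₀ hwp.le hw1'
  have c3 : C1 ^ 2 * w ^ 2 * 15 ≤ B * w ^ 2 := by
    have := mul_le_mul_of_nonneg_right hBC (sq_nonneg w)
    nlinarith only [this, sq_nonneg w]
  have c4 : B * w * w ^ 2 ≤ B * w * 1 := mul_le_mul_of_nonneg_left c2 (by positivity)
  have c5 : (B * w) ^ 2 * w ^ 2 ≤ (B * w) ^ 2 * 1 := mul_le_mul_of_nonneg_left c2 (by positivity)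
  have c6 : B * w ^ 2 * 2 ≤ B * w ^ 2 * B := mul_le_mul_of_nonneg_left hB2 (by positivity)
  have c7 : 0 < B * w := by positivity
  have c8 : 0 < B * w ^ 2 * (B * w) := by positivity
  nlinarith only [c1,c3,c4,c5,c6,c7,c8]

lemma fin5 {B w C0 C1 C2 p u o D l z : ℝ} (hC0 : 2 ≤ C0) (hC1 : 1 ≤ C1) (hC2 : 1 ≤ C2)
    (hB : 2 + 3 * C0 * C2 + 4 * C0 * C1 ^ 2 + 15 * C1 ^ 2 ≤ B) (hB2 : 2 ≤ B)
    (hp0 : 0 ≤ p) (hu0 : 0 ≤ u) (hn2 : p < C0) (hnB2 : p < 1 + B * w) (hx2 : u < C2 * w ^ 2)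
    (hD : 0 ≤ D) (hD1 : D ≤ -(2 * l)) (hlw' : -l < C1 * w) (hw1' : w ≤ 1)
    (hwp : 0 < w) (hom : o ≤ 2) (homp : 0 < o) (hog : 2 - o ≤ 16 / 9 * l ^ 2) :
    -2 * (B * w) ^ 2 - 4 * p * (B * w) + 4 * p ^ 2 - 2 * o * p + o * (B * w ^ 2)
      + (B * (2 * w ^ 3) - 4 * (B * w ^ 2)) * p
      + u * (-(4 / 9) * (B * w) + 4 / 9 * p - 4 / 9 * o - 4 / 9 * z + 4 / 9 * z)
      + 2 * p * u + 9 / 8 * (16 / 9 * D) ^ 2 < 0 := by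
  have hC0p : 0 < C0 := by linarith
  have hC2p : 0 < C2 := by linarith
  have hC1p : 0 < C1 := by linarith
  have c1 : (D) ^ 2 ≤ (2 * (C1 * w)) ^ 2 :=
    pow_le_pow_left₀ hD (by linarith) 2
  have c2 : l ^ 2 ≤ (C1 * w) ^ 2 := by
    rw [← neg_sq]; exact pow_le_pow_left₀ (by linarith) hlw'.le 2
  have c3 : (16 / 9 * D) ^ 2 ≤ 1024 / 81 * (C1 ^ 2 * w ^ 2) := by
    nlinarith only [c1]
  have c4 : (2 - o) * p ≤ 16 / 9 * (C1 * w) ^ 2 * C0 :=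
    mul_le_mul (by linarith) hn2.le hp0 (by positivity)
  have c5 : 0 ≤ p * (1 + B * w - p) := mul_nonneg hp0 (by linarith)
  have c6 : o * (B * w ^ 2) ≤ 2 * (B * w ^ 2) := mul_le_mul_of_nonneg_right hom (by positivity)
  have c7 : (B * (2 * w ^ 3) - 4 * (B * w ^ 2)) * p ≤ 0 := by
    apply mul_nonpos_of_nonpos_of_nonneg _ hp0
    have : B * w ^ 2 * w ≤ B * w ^ 2 * 1 := mul_le_mul_of_nonneg_left hw1' (by positivity)
    have : 0 ≤ B * w ^ 2 := by positivity
    linarith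
  have c8 : p * u ≤ C0 * (C2 * w ^ 2) := mul_le_mul hn2.le hx2.le hu0 (by linarith)
  have c9 : 0 ≤ u * (B * w) := by positivity
  have c10 : 0 ≤ u * o := mul_nonneg hu0 homp.le
  have c11 : 0 < w ^ 2 := by positivity
  have c12 : w ^ 2 * (2 + 3 * C0 * C2 + 4 * C0 * C1 ^ 2 + 15 * C1 ^ 2) ≤ w ^ 2 * B :=
    mul_le_mul_of_nonneg_left hB c11.le
  have c13 : w ^ 2 * B * 2 ≤ w ^ 2 * B * B := mul_le_mul_of_nonneg_left hB2 (by positivity)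
  have c14 : 0 ≤ C0 * C1 ^ 2 * w ^ 2 := by positivity
  have c15 : 0 ≤ C1 ^ 2 * w ^ 2 := by positivity
  have c16 : 0 ≤ C0 * C2 * w ^ 2 := by positivity
  nlinarith only [c3, c4, c5, c6, c7, c8, c9, c10, c12, c13, c14, c15, c16, hx2, c11, hB2]

lemma est_B {T t0 A C0 C1 C2 : ℝ} {F : Fl} (S : Sys T F) (ht0 : 0 < t0) (ht0T : t0 < T)
    (hl : ∀ y t, 0 ≤ t → t < T → F.l y t ≤ 0)
    (hA : ∀ y t, t0 ≤ t → t < T → F.m y t < A)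
    (hC0 : 2 ≤ C0) (hC1 : 1 ≤ C1) (hC2 : 1 ≤ C2)
    (hn : ∀ y t, t0 ≤ t → t < T → F.n y t ^ 2 < C0 * EE (F.m y t))
    (hlw : ∀ y t, t0 ≤ t → t < T → -F.l y t < C1 * wf A (F.m y t))
    (hxw : ∀ y t, t0 ≤ t → t < T →
      F.x y t ^ 2 < C2 * wf A (F.m y t) ^ 2 * EE (F.m y t))
    (hw1 : ∀ y t, t0 ≤ t → t < T → wf A (F.m y t) ≤ 1) :
    ∃ B, 1 ≤ B ∧ ∀ y t, t0 ≤ t → t < T →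
      F.k y t + F.n y t ^ 2 + 2 / 9 * F.x y t ^ 2 < B * wf A (F.m y t) * EE (F.m y t) := by
  have hcx := (S.c_x.toJC0 ht0).slice le_rfl ht0T
  have hcn := (S.c_n.toJC0 ht0).slice le_rfl ht0T
  have hck := (S.c_k.toJC0 ht0).slice le_rfl ht0T
  have hcm := (S.c_m).slice ht0.le ht0T
  obtain ⟨Ca, hCa⟩ := per_bdd
    (φ := fun y => F.n y t0 ^ 2 * Real.exp (2 * F.m y t0) * (A - F.m y t0))
    (((hcn.pow 2).mul (Real.continuous_exp.comp (continuous_const.mul hcm))).mul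
      ((continuous_const.sub hcm)))
    (fun y => by simp only [S.per_n y t0, S.per_m y t0])
  obtain ⟨Cb, hCb⟩ := per_bdd
    (φ := fun y => (F.k y t0 + F.n y t0 ^ 2 + 2 / 9 * F.x y t0 ^ 2)
      * Real.exp (2 * F.m y t0) * (A - F.m y t0))
    (((((hck.add (hcn.pow 2))).add (continuous_const.mul (hcx.pow 2))).mul
      (Real.continuous_exp.comp (continuous_const.mul hcm))).mul
      ((continuous_const.sub hcm)))
    (fun y => by simp only [S.per_n y t0, S.per_m y t0, S.per_k y t0, S.per_x y t0])
  obtain ⟨B, hBa, hBb, hB⟩ : ∃ B, Ca ≤ B ∧ Cb ≤ B ∧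
      2 + 3 * C0 * C2 + 4 * C0 * C1 ^ 2 + 15 * C1 ^ 2 ≤ B :=
    ⟨max (max Ca Cb) (2 + 3 * C0 * C2 + 4 * C0 * C1 ^ 2 + 15 * C1 ^ 2),
      (le_max_left _ _).trans (le_max_left _ _), (le_max_right _ _).trans (le_max_left _ _),
      le_max_right _ _⟩
  have hC0p : 0 < C0 := by linarith
  have hC2p : 0 < C2 := by linarith
  have hC1p : 0 < C1 := by linarith
  have q1 : 0 < C0 * C2 := by positivity
  have q2 : 0 < C0 * C1 ^ 2 := by positivity
  have hBC : 15 * C1 ^ 2 + 2 ≤ B := by linarith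
  have hB2 : 2 ≤ B := by nlinarith
  have hnB := est_n S ht0 hl hA (P := fun z => 1 + B * wf A z) (P1 := fun z => B * wf A z ^ 2)
    (P2 := fun z => B * (2 * wf A z ^ 3))
    (fun z h => ((wf_der h).const_mul _).const_add _) (fun z h => (wf_der2 h).const_mul _) ?_
    (fun z h => by have := wf_pos h; positivity)
    (fun z h => by have := wf_pos h; positivity) ?_
  rotate_left
  · intro y
    have h3 := lt_of_lt_of_le (hCa y) hBa
    have h4 : 0 < A - F.m y t0 := by linarith [hA y t0 le_rfl ht0T]
    have h5 := one_div_EE (F.m y t0)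
    have h6 : F.n y t0 ^ 2 * Real.exp (2 * F.m y t0) < B * wf A (F.m y t0) := by
      unfold wf
      rw [← div_eq_mul_inv, lt_div_iff₀ (by positivity)]
      exact h3
    calc F.n y t0 ^ 2 = F.n y t0 ^ 2 * Real.exp (2 * F.m y t0) * EE (F.m y t0) := by
          rw [mul_assoc, mul_comm (Real.exp _), h5, mul_one]
      _ < _ := mul_lt_mul_of_pos_right (by linarith) (EE_pos _)
  · intro y t h1 h2
    have hl' := hl y t (by linarith) h2
    have hD := D_nonneg hl'
    have hD1 := D_le hl'
    have hlw' := hlw y t h1.le h2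
    have hw1' := hw1 y t h1.le h2
    have hwp := wf_pos (hA y t h1.le h2)
    exact fin4 hBC hB2 hD hD1 hlw' hw1' hwp
  refine ⟨B, by linarith, ?_⟩
  refine barrierE S ht0 hA (P := fun z => B * wf A z)
    (P1 := fun z => B * wf A z ^ 2) (P2 := fun z => B * (2 * wf A z ^ 3))
    (fun z h => (wf_der h).const_mul _)
    (fun z h => (wf_der2 h).const_mul _)
    (N := fun y t => F.k y t + F.n y t ^ 2 + 2 / 9 * F.x y t ^ 2)
    (N1 := fun y t => F.k1 y t + 2 * F.n y t * F.k y t + 4 / 9 * F.x y t * F.x1 y t)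
    (N2 := fun y t => F.k2 y t + 2 * (F.k y t * F.k y t + F.n y t * F.k1 y t)
      + 4 / 9 * (F.x1 y t * F.x1 y t + F.x y t * F.x2 y t))
    (Nt := fun y t => (F.k2 y t + 3 * F.n y t * F.k1 y t
    - 12 * F.n y t ^ 2 * F.k y t - 4 / 3 * F.x y t ^ 2 * F.k y t
    - 4 / 3 * F.n y t * F.x y t * F.x1 y t
    + EE (F.m y t) * (2 * om (XX (F.l y t)) * F.k y t
      - 4 * om (XX (F.l y t)) * F.n y t ^ 2 + 4 * om1 (XX (F.l y t)) * F.n y t * F.x y t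
      - om2 (XX (F.l y t)) * F.x y t ^ 2 - om1 (XX (F.l y t)) * F.x1 y t))
    + 2 * F.n y t * (F.k1 y t + 3 * F.n y t * F.k y t
    - (3 * F.n y t ^ 2 + 2 / 3 * F.x y t ^ 2) * F.n y t
    + EE (F.m y t) * (2 * om (XX (F.l y t)) * F.n y t - om1 (XX (F.l y t)) * F.x y t))
    + 4 / 9 * F.x y t * (F.x2 y t + 3 * F.n y t * F.x1 y t
    - (3 * F.n y t ^ 2 + 2 / 3 * F.x y t ^ 2) * F.x y t
    + EE (F.m y t) * (ze1 (XX (F.l y t)) * F.x y t - 2 * ze (XX (F.l y t)) * F.n y t)))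
    ?_ ?_ ?_ ?_ ?_ ?_ ?_
  · exact ContinuousOn.add (ContinuousOn.add (S.c_k.toJC0 ht0)
      (ContinuousOn.pow (S.c_n.toJC0 ht0) 2))
      (ContinuousOn.mul continuousOn_const (ContinuousOn.pow (S.c_x.toJC0 ht0) 2))
  · intro y t; simp only [S.per_x y t, S.per_k y t, S.per_n y t]
  · intro y
    have h3 := lt_of_lt_of_le (hCb y) hBb
    have h4 : 0 < A - F.m y t0 := by linarith [hA y t0 le_rfl ht0T]
    have h5 := one_div_EE (F.m y t0)
    set N := F.k y t0 + F.n y t0 ^ 2 + 2 / 9 * F.x y t0 ^ 2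
    have h6 : N * Real.exp (2 * F.m y t0) < B * wf A (F.m y t0) := by
      unfold wf
      rw [← div_eq_mul_inv, lt_div_iff₀ (by positivity)]
      exact h3
    calc N = N * Real.exp (2 * F.m y t0) * EE (F.m y t0) := by
          rw [mul_assoc, mul_comm (Real.exp _), h5, mul_one]
      _ < _ := mul_lt_mul_of_pos_right h6 (EE_pos _)
  · intro y t h1 h2
    refine (((S.dk y t (by linarith) h2).add ((S.dn y t (by linarith) h2).pow 2)).add
      (((S.dx y t (by linarith) h2).pow 2).const_mul (2 / 9))).congr_deriv (by simp; ring)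
  · intro y t h1 h2
    refine (((S.dk1 y t (by linarith) h2).add (((S.dn y t (by linarith) h2).const_mul 2).mul
      (S.dk y t (by linarith) h2))).add
      (((S.dx y t (by linarith) h2).const_mul (4 / 9)).mul
      (S.dx1 y t (by linarith) h2))).congr_deriv (by ring)
  · intro y t h1 h2
    refine (((S.tk y t (by linarith) h2).add ((S.tn y t (by linarith) h2).pow 2)).add
      (((S.tx y t (by linarith) h2).pow 2).const_mul (2 / 9))).congr_deriv (by simp; ring)
  · intro y t e h1 h2 he hE q0 q1 q2
    have hl' := hl y t (by linarith) h2
    have hn' := hn y t h1.le h2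
    have hnB' := hnB y t h1.le h2
    have hxw' := hxw y t h1.le h2
    simp only [hE] at hn' hnB' hxw' ⊢
    refine alg_k he ?_ q0 q1 q2
    intro p u hp hu
    rw [hp] at hn' hnB'
    rw [hu] at hxw'
    have he2 : 0 < e ^ 2 := by positivity
    have hp0 : 0 ≤ p := by
      by_contra hcon
      push Not at hcon
      have := mul_neg_of_neg_of_pos hcon he2
      nlinarith [sq_nonneg (F.n y t)]
    have hu0 : 0 ≤ u := by
      by_contra hcon
      push Not at hcon
      have := mul_neg_of_neg_of_pos hcon he2
      nlinarith [sq_nonneg (F.x y t)]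
    have hn2 := lt_of_mul_lt_mul_right hn' he2.le
    have hnB2 := lt_of_mul_lt_mul_right hnB' he2.le
    have hx2 := lt_of_mul_lt_mul_right hxw' he2.le
    have hD := D_nonneg hl'
    have hD1 := D_le hl'
    have hlw' := hlw y t h1.le h2
    have hw1' := hw1 y t h1.le h2
    have hwp := wf_pos (hA y t h1.le h2)
    have hom := om_le (XX_pos (F.l y t))
    have homp := om_pos (XX_pos (F.l y t)) (XX_le hl')
    have hog := om_ge hl'
    have hzz : om2 (XX (F.l y t)) = 4 / 9 * ze1 (XX (F.l y t)) := by unfold om2 ze1; ring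
    rw [hzz]
    exact fin5 hC0 hC1 hC2 hB hB2 hp0 hu0 hn2 hnB2 hx2 hD hD1 hlw' hw1' hwp hom homp hog


structure Est (T t0 A C1 C2 B : ℝ) (F : Fl) : Prop where
  ht0 : 0 < t0
  ht0T : t0 < T
  C1_ge : 1 ≤ C1
  C2_ge : 1 ≤ C2
  B_ge : 1 ≤ B
  mA : ∀ y t, t0 ≤ t → t < T → F.m y t < A
  l0 : ∀ y t, t0 ≤ t → t < T → F.l y t ≤ 0
  w1 : ∀ y t, t0 ≤ t → t < T → wf A (F.m y t) ≤ 1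
  lw : ∀ y t, t0 ≤ t → t < T → -F.l y t < C1 * wf A (F.m y t)
  xw : ∀ y t, t0 ≤ t → t < T → F.x y t ^ 2 < C2 * wf A (F.m y t) ^ 2 * EE (F.m y t)
  kw : ∀ y t, t0 ≤ t → t < T →
      F.k y t + F.n y t ^ 2 + 2 / 9 * F.x y t ^ 2 < B * wf A (F.m y t) * EE (F.m y t)

lemma exists_est {T : ℝ} {F : Fl} (S : Sys T F) (hl0 : ∀ y, F.l y 0 ≤ 0) :
    ∃ t0 A C1 C2 B, Est T t0 A C1 C2 B F := by
  have hT := S.T_pos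
  obtain ⟨t0, ht0, ht0T⟩ : ∃ t0, 0 < t0 ∧ t0 < T := ⟨T / 2, by linarith, by linarith⟩
  have hl := est_l0 S hl0
  obtain ⟨M1, hM1⟩ := est_m S ht0 ht0T hl
  obtain ⟨L, hL, hlL⟩ := est_L S ht0 ht0T
  obtain ⟨c0, hc0, hz⟩ := ze_ge hL
  obtain ⟨C0, hC0, hn⟩ := est_C0 S ht0 ht0T hl hM1
  set X0 := XX (-L) ^ 4 with hX0d
  have hX0 : 0 < X0 := pow_pos (XX_pos _) 4
  have hX : ∀ y t, t0 ≤ t → t < T → X0 ≤ XX (F.l y t) ^ 4 := by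
    intro y t h1 h2
    apply pow_le_pow_left₀ (XX_pos _).le
    unfold XX
    have := hlL y t h1 h2
    exact Real.exp_le_exp.2 (by linarith)
  obtain ⟨δ, hδ, hδ1, hδ2, hδ3, hδ4⟩ : ∃ δ : ℝ, 0 < δ ∧ δ ≤ 1 ∧ δ ≤ X0 ∧ C0 * δ ≤ 1 ∧ 5 * δ ≤ c0 := by
    refine ⟨min (min 1 X0) (min (1 / C0) (c0 / 5)), by positivity,
      (min_le_left _ _).trans (min_le_left _ _), (min_le_left _ _).trans (min_le_right _ _), ?_, ?_⟩
    · have h : min (min 1 X0) (min (1 / C0) (c0 / 5)) ≤ 1 / C0 :=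
        (min_le_right _ _).trans (min_le_left _ _)
      rw [le_div_iff₀ (by linarith)] at h
      linarith
    · have h : min (min 1 X0) (min (1 / C0) (c0 / 5)) ≤ c0 / 5 :=
        (min_le_right _ _).trans (min_le_right _ _)
      linarith
  set A := M1 + 1 / δ with hAd
  have hδi : 0 < 1 / δ := by positivity
  have hA : ∀ y t, t0 ≤ t → t < T → F.m y t < A := by
    intro y t h1 h2; have := hM1 y t h1 h2; linarith
  have hw : ∀ y t, t0 ≤ t → t < T → wf A (F.m y t) ≤ δ := by
    intro y t h1 h2
    have h3 := hM1 y t h1 h2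
    unfold wf
    rw [inv_le_comm₀ (by linarith) hδ]
    rw [one_div] at hAd
    linarith
  have hw1 : ∀ y t, t0 ≤ t → t < T → wf A (F.m y t) ≤ 1 := fun y t h1 h2 => (hw y t h1 h2).trans hδ1
  obtain ⟨C1, hC1, hlw⟩ := est_w1 S ht0 ht0T hA hn
    (fun y t h1 h2 => hz _ (hlL y t h1 h2).le (hl y t (by linarith) h2))
    (fun y t h1 h2 => by
      have a := hw y t h1 h2
      have b := wf_pos (hA y t h1 h2)
      have c : C0 * wf A (F.m y t) ≤ 1 := by nlinarith only [hC0, a, hδ3]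
      nlinarith only [a, b, c, hδ4])
  obtain ⟨C2, hC2, hxw⟩ := est_w2 S ht0 ht0T hl hA hn hX0 hX hlw
    (fun y t h1 h2 => (hw y t h1 h2).trans hδ2)
    (fun y t h1 h2 => by
      have a := hw y t h1 h2
      nlinarith only [hC0, a, hδ3])
  obtain ⟨B, hB, hkw⟩ := est_B S ht0 ht0T hl hA hC0 hC1 hC2 hn hlw hxw hw1
  exact ⟨t0, A, C1, C2, B, ht0, ht0T, hC1, hC2, hB, hA,
    fun y t h1 h2 => hl y t (by linarith) h2, hw1, hlw, hxw, hkw⟩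


lemma minp {a T : ℝ} {G Gt : ℝ → ℝ → ℝ}
    (hc : JC0 a T G) (hper : Per G)
    (ht : ∀ y t, a ≤ t → t < T → HasDerivAt (fun s => G y s) (Gt y t) t)
    (hneg : ∀ y t, a ≤ t → t < T → G y t < 0 → (∀ z, G y t ≤ G z t) → Gt y t < 0)
    (hend : ∀ ε > 0, ∃ t2 < T, ∀ y t, a ≤ t → t2 ≤ t → t < T → -ε < G y t) :
    ∀ y t, a ≤ t → t < T → 0 ≤ G y t := by
  intro y1 t1 hat1 ht1T
  by_contra hcon
  push Not at hcon
  obtain ⟨t2, ht2T, ht2⟩ := hend (-G y1 t1) (by linarith)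
  set ε := -G y1 t1 with hε
  have hεp : 0 < ε := by linarith
  set b := max t1 t2 with hb
  have hbT : b < T := max_lt ht1T ht2T
  have hab : t1 ≤ b := le_max_left _ _
  set s : Set ℝ := {t | ∃ z ∈ Icc (0:ℝ) (2 * π), G z t ≤ -ε} with hs
  have hsub : Icc t1 b ⊆ s := by
    apply IsClosed.Icc_subset_of_forall_exists_gt
    · have : s ∩ Icc t1 b = Prod.snd '' ((Icc (0:ℝ) (2 * π) ×ˢ Icc t1 b) ∩
          (fun p : ℝ × ℝ => G p.1 p.2) ⁻¹' (Iic (-ε))) := by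
        ext t
        constructor
        · rintro ⟨⟨z, hz, hG⟩, htI⟩
          exact ⟨(z, t), ⟨⟨hz, htI⟩, hG⟩, rfl⟩
        · rintro ⟨⟨z, t'⟩, ⟨⟨hz, htI⟩, hG⟩, rfl⟩
          exact ⟨⟨z, hz, hG⟩, htI⟩
      rw [this]
      apply IsCompact.isClosed
      apply IsCompact.image _ continuous_snd
      have hK : IsCompact (Icc (0:ℝ) (2 * π) ×ˢ Icc t1 b) := isCompact_Icc.prod isCompact_Icc
      apply hK.of_isClosed_subset _ inter_subset_left
      apply ContinuousOn.preimage_isClosed_of_isClosed _ hK.isClosed isClosed_Iic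
      apply ContinuousOn.mono hc
      rintro ⟨z, t⟩ ⟨_, h⟩
      exact ⟨trivial, hat1.trans h.1, lt_of_le_of_lt h.2 hbT⟩
    · obtain ⟨z, hz, h⟩ := exists_mem_period (Q := fun y => G y t1) (fun y => hper y t1) y1
      have h' : G z t1 = G y1 t1 := h
      exact ⟨z, hz, by rw [h', hε]; linarith⟩
    · rintro t ⟨⟨z, hz, hG⟩, htI⟩ u hu
      have htT : t < T := htI.2.trans hbT
      have hat : a ≤ t := hat1.trans htI.1
      obtain ⟨v, hv, hvmin⟩ := (isCompact_Icc (a := (0:ℝ)) (b := 2 * π)).exists_isMinOn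
        ⟨0, ⟨le_rfl, by positivity⟩⟩ (hc.slice hat htT).continuousOn
      have hvall : ∀ q, G v t ≤ G q t := by
        intro q
        obtain ⟨q', hq', h⟩ := exists_mem_period (Q := fun y => G y t) (fun y => hper y t) q
        have h' : G q' t = G q t := h
        rw [← h']; exact hvmin hq'
      have hvε : G v t ≤ -ε := (hvmin hz).trans hG
      have hd := hneg v t hat htT (by linarith) hvall
      have hsl : Tendsto (slope (fun s => G v s) t) (𝓝[>] t) (𝓝 (Gt v t)) :=
        (hasDerivAt_iff_tendsto_slope.1 (ht v t hat htT)).mono_left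
          (nhdsWithin_mono t (fun s hs => ne_of_gt hs))
      have hev := hsl.eventually (gt_mem_nhds hd)
      have hu' : t < u := hu
      obtain ⟨q, hq1, hq2⟩ := (hev.and (Ioo_mem_nhdsGT hu')).exists
      refine ⟨q, ⟨v, hv, ?_⟩, hq2.1, hq2.2.le⟩
      rw [slope_def_field] at hq1
      have : 0 < q - t := by linarith [hq2.1]
      have h9 := (div_neg_iff.1 hq1)
      rcases h9 with h9 | h9
      · linarith
      · linarith
  obtain ⟨z, _, hz⟩ := hsub ⟨hab, le_rfl⟩
  have := ht2 z b (hat1.trans hab) (le_max_right _ _) hbT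
  linarith

def tc (A T t : ℝ) : ℝ := wf A (Real.log (4 * (T - t)) / 2)
def th (A C4 T t : ℝ) : ℝ := (4 - C4 * tc A T t) * (T - t)

lemma tc_der {A T t : ℝ} (ht : t < T) (hA : Real.log (4 * (T - t)) / 2 < A) :
    HasDerivAt (tc A T) (-(tc A T t ^ 2 / (2 * (T - t)))) t := by
  have h1 : HasDerivAt (fun t => 4 * (T - t)) (-4) t := by
    have := ((hasDerivAt_id t).const_sub T).const_mul 4
    simpa using this
  have hp : 0 < T - t := by linarith
  have h2 := (h1.log (by positivity)).div_const 2
  have h3 := (wf_der hA).comp t h2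
  refine h3.congr_deriv ?_
  unfold tc
  field_simp

lemma th_der {A C4 T t : ℝ} (ht : t < T) (hA : Real.log (4 * (T - t)) / 2 < A) :
    HasDerivAt (th A C4 T) (-4 + C4 * tc A T t + C4 * tc A T t ^ 2 / 2) t := by
  have h1 := ((tc_der ht hA).const_mul C4).const_sub 4
  have h2 := h1.mul ((hasDerivAt_id t).const_sub T)
  refine h2.congr_deriv ?_
  have hp : T - t ≠ 0 := by linarith
  simp only [id]
  field_simp
  ring

lemma exists_tstar {A T t0 η : ℝ} (ht0 : t0 < T) (hη : 0 < η) :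
    ∃ a, t0 < a ∧ a < T ∧ ∀ t, a ≤ t → t < T →
      Real.log (4 * (T - t)) / 2 < A ∧ 0 < tc A T t ∧ tc A T t ≤ η := by
  have he := Real.exp_pos (2 * (A - 1 / η))
  refine ⟨max ((t0 + T) / 2) (T - Real.exp (2 * (A - 1 / η)) / 4), lt_of_lt_of_le (by linarith)
    (le_max_left _ _), max_lt (by linarith) (by linarith), ?_⟩
  intro t h1 h2
  have h3 : T - Real.exp (2 * (A - 1 / η)) / 4 ≤ t := (le_max_right _ _).trans h1
  have hp : 0 < T - t := by linarith
  have h4 : Real.log (4 * (T - t)) ≤ 2 * (A - 1 / η) := by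
    rw [Real.log_le_iff_le_exp (by positivity)]; linarith
  have hη' : 0 < 1 / η := by positivity
  have h5 : Real.log (4 * (T - t)) / 2 < A := by linarith
  refine ⟨h5, wf_pos h5, ?_⟩
  unfold tc wf
  rw [inv_le_comm₀ (by linarith) hη, ← one_div]
  linarith

lemma wf_mono {A u v : ℝ} (h : u ≤ v) (hv : v < A) : wf A u ≤ wf A v := by
  unfold wf
  exact inv_anti₀ (by linarith) (by linarith)

/-- lower bound for `e^{2m}` -/
lemma est_low {T t0 A C1 C2 B C4 a : ℝ} {F : Fl} (S : Sys T F) (H : Est T t0 A C1 C2 B F)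
    (hC4 : 2 * B + 4 * C1 ^ 2 ≤ C4) (ha0 : t0 ≤ a)
    (ha : ∀ t, a ≤ t → t < T → Real.log (4 * (T - t)) / 2 < A ∧ 0 < tc A T t) :
    ∀ y t, a ≤ t → t < T → th A C4 T t ≤ Real.exp (2 * F.m y t) := by
  have hB := H.B_ge
  have hC4p : 0 < C4 := by nlinarith [sq_nonneg C1]
  have ht0 := H.ht0
  have main := minp (a := a) (T := T)
    (G := fun y t => Real.exp (2 * F.m y t) - th A C4 T t)
    (Gt := fun y t => Real.exp (2 * F.m y t) * (2 * (F.k y t + 3 * F.n y t ^ 2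
      - om (XX (F.l y t)) * EE (F.m y t))) - (-4 + C4 * tc A T t + C4 * tc A T t ^ 2 / 2))
    ?_ ?_ ?_ ?_ ?_
  · intro y t h1 h2; have := main y t h1 h2; linarith
  · apply ContinuousOn.sub
    · exact Real.continuous_exp.comp_continuousOn
        (continuousOn_const.mul (S.c_m.toJC0 (by linarith)))
    · have : ContinuousOn (th A C4 T) (Ico a T) := fun t ht =>
        (th_der ht.2 (ha t ht.1 ht.2).1).continuousAt.continuousWithinAt
      exact this.comp continuousOn_snd (fun p hp => hp.2)
  · intro y t; simp only [S.per_m y t]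
  · intro y t h1 h2
    exact (((S.tm y t (by linarith) h2).const_mul 2).exp).sub (th_der h2 (ha t h1 h2).1)
  · intro y t h1 h2 hG hmin
    have hp : 0 < T - t := by linarith
    obtain ⟨hlA, hcp⟩ := ha t h1 h2
    have hn : F.n y t = 0 := by
      have hm : ∀ z, F.m y t ≤ F.m z t := by
        intro z
        have := hmin z
        have h3 : Real.exp (2 * F.m y t) ≤ Real.exp (2 * F.m z t) := by linarith
        have := Real.exp_le_exp.1 h3
        linarith
      have hloc : IsLocalMin (fun z => F.m z t) y := Filter.Eventually.of_forall hm
      have := hloc.hasDerivAt_eq_zero (S.dm y t (by linarith) h2)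
      rcases mul_eq_zero.1 this with h | h
      · exact absurd h (S.ρ_pos y t (by linarith) h2).ne'
      · exact h
    have hk := H.kw y t (by linarith) h2
    have hl := H.l0 y t (by linarith) h2
    have hlw := H.lw y t (by linarith) h2
    have hw1 := H.w1 y t (by linarith) h2
    have hwp := wf_pos (H.mA y t (by linarith) h2)
    have hog := om_ge hl
    have hwc : wf A (F.m y t) ≤ tc A T t := by
      apply wf_mono _ hlA
      have h5 : th A C4 T t ≤ 4 * (T - t) := by
        unfold th
        have : 0 ≤ C4 * tc A T t * (T - t) := by positivity
        nlinarith
      have h6 : Real.exp (2 * F.m y t) ≤ 4 * (T - t) := by linarith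
      have h7 := (Real.le_log_iff_exp_le (by positivity)).2 h6
      linarith
    have hE := one_div_EE (F.m y t)
    set w := wf A (F.m y t)
    set o := om (XX (F.l y t))
    set E := EE (F.m y t)
    set h := Real.exp (2 * F.m y t)
    have hhp : 0 < h := Real.exp_pos _
    rw [hn] at hk ⊢
    have e1 : h * F.k y t < B * w := by
      have h8 : F.k y t < B * w * E := by nlinarith only [hk, sq_nonneg (F.x y t)]
      have := mul_lt_mul_of_pos_left h8 hhp
      calc h * F.k y t < h * (B * w * E) := this
        _ = B * w * (E * h) := by ring
        _ = B * w := by rw [hE, mul_one]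
    have e2 : F.l y t ^ 2 ≤ (C1 * w) ^ 2 := by
      rw [← neg_sq]; exact pow_le_pow_left₀ (by linarith) hlw.le 2
    have e3 : C1 ^ 2 * (w * w) ≤ C1 ^ 2 * (w * 1) :=
      mul_le_mul_of_nonneg_left (mul_le_mul_of_nonneg_left hw1 hwp.le) (sq_nonneg _)
    have e4 : h * (2 * (F.k y t + 3 * 0 ^ 2 - o * E)) = 2 * (h * F.k y t) - 2 * o * (E * h) := by
      ring
    rw [e4, hE]
    have e5 : C4 * w ≤ C4 * tc A T t := mul_le_mul_of_nonneg_left hwc hC4p.le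
    have e6 : (2 * B + 4 * C1 ^ 2) * w ≤ C4 * w := mul_le_mul_of_nonneg_right hC4 hwp.le
    have e7 : 0 < C4 * tc A T t ^ 2 / 2 := by positivity
    have e8 : 0 ≤ C1 ^ 2 * w := by positivity
    nlinarith only [e1, e2, e3, e5, e6, e7, hog, e8]
  · intro ε hε
    refine ⟨T - ε / 8, by linarith, ?_⟩
    intro y t h1 h2 h3
    obtain ⟨hlA, hcp⟩ := ha t h1 h3
    have hp : 0 < T - t := by linarith
    have h5 : th A C4 T t ≤ 4 * (T - t) := by
      unfold th
      have : 0 ≤ C4 * tc A T t * (T - t) := by positivity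
      nlinarith
    have := Real.exp_pos (2 * F.m y t)
    linarith


lemma est_p {T t0 A C1 C2 B t q : ℝ} {F : Fl} (S : Sys T F) (H : Est T t0 A C1 C2 B F)
    (h1 : t0 ≤ t) (h2 : t < T) (hz : ∀ y, 0 ≤ 2 * F.m y t - q) :
    ∀ y, F.n y t ^ 2 * Real.exp (2 * F.m y t) ≤
      2 * B * wf A (F.m y t) * (2 * F.m y t - q) := by
  have ht0 := H.ht0
  have hB := H.B_ge
  have hcn := (S.c_n.toJC0 ht0).slice h1 h2
  have hcm := (S.c_m).slice (by linarith : (0:ℝ) ≤ t) h2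
  have hcw : Continuous (fun y => wf A (F.m y t)) := by
    unfold wf
    exact (continuous_const.sub hcm).inv₀ (fun y => (sub_pos.2 (H.mA y t h1 h2)).ne')
  set G : ℝ → ℝ := fun y => F.n y t ^ 2 * Real.exp (2 * F.m y t)
    - 2 * B * wf A (F.m y t) * (2 * F.m y t - q) with hG
  have hGc : Continuous G :=
    ((hcn.pow 2).mul (Real.continuous_exp.comp (continuous_const.mul hcm))).sub
      ((continuous_const.mul hcw).mul ((continuous_const.mul hcm).sub continuous_const))
  have hGp : ∀ y, G (y + 2 * π) = G y := by
    intro y; simp only [hG, S.per_n y t, S.per_m y t]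
  obtain ⟨v, hv, hvmax⟩ := (isCompact_Icc (a := (0:ℝ)) (b := 2 * π)).exists_isMaxOn
    ⟨0, ⟨le_rfl, by positivity⟩⟩ hGc.continuousOn
  have hall : ∀ y, G y ≤ G v := by
    intro y
    obtain ⟨y', hy', h⟩ := exists_mem_period hGp y
    rw [← h]; exact hvmax hy'
  have hmA := H.mA v t h1 h2
  have hwp := wf_pos hmA
  have hder : HasDerivAt G (F.ρ v t * (2 * F.n v t * ((F.k v t + F.n v t ^ 2) *
      Real.exp (2 * F.m v t) - B * (wf A (F.m v t) ^ 2 * (2 * F.m v t - q)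
        + 2 * wf A (F.m v t))))) v := by
    have dn := S.dn v t (by linarith) h2
    have dm := S.dm v t (by linarith) h2
    have dw := (wf_der hmA).comp v dm
    have := ((dn.pow 2).mul ((dm.const_mul 2).exp)).sub
      ((dw.const_mul (2 * B)).mul ((dm.const_mul 2).sub_const q))
    refine this.congr_deriv ?_
    simp
    ring
  have hzero := (show IsLocalMax G v from Filter.Eventually.of_forall hall).hasDerivAt_eq_zero hder
  have hρ := S.ρ_pos v t (by linarith) h2
  have hn0 : F.n v t = 0 := by
    by_contra hn
    have h3 : (F.k v t + F.n v t ^ 2) *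
      Real.exp (2 * F.m v t) - B * (wf A (F.m v t) ^ 2 * (2 * F.m v t - q)
        + 2 * wf A (F.m v t)) = 0 := by
      rcases mul_eq_zero.1 hzero with h | h
      · exact absurd h hρ.ne'
      · rcases mul_eq_zero.1 h with h | h
        · exact absurd h (by positivity)
        · exact h
    have hk := H.kw v t h1 h2
    have hE := one_div_EE (F.m v t)
    have h4 : F.k v t + F.n v t ^ 2 < B * wf A (F.m v t) * EE (F.m v t) := by
      nlinarith only [hk, sq_nonneg (F.x v t)]
    have h5 := mul_lt_mul_of_pos_right h4 (Real.exp_pos (2 * F.m v t))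
    rw [mul_assoc, hE, mul_one] at h5
    have h6 : 0 ≤ B * (wf A (F.m v t) ^ 2 * (2 * F.m v t - q)) := by
      have := hz v; positivity
    have h7 : 0 < B * wf A (F.m v t) := by positivity
    linarith
  have hGv : G v ≤ 0 := by
    simp only [hG, hn0]
    have : 0 ≤ 2 * B * wf A (F.m v t) * (2 * F.m v t - q) := by
      have := hz v; positivity
    linarith
  intro y
  have := (hall y).trans hGv
  simp only [hG] at this
  linarith

lemma est_wc {A m q c : ℝ} (hm : m < A) (hw1 : wf A m ≤ 1) (hz : 0 ≤ 2 * m - q)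
    (hc : wf A (q / 2) ≤ c) : wf A m ≤ c * (1 + (2 * m - q) / 2) := by
  have hq : q / 2 < A := by linarith
  have h1 := wf_pos hm
  have h2 := wf_pos hq
  have e : wf A m = wf A (q / 2) + wf A (q / 2) * wf A m * ((2 * m - q) / 2) := by
    unfold wf
    have a1 : A - m ≠ 0 := by linarith
    have a2 : A - q / 2 ≠ 0 := by linarith
    have a3 : (2 * m - q) / 2 = (A - q / 2) - (A - m) := by ring
    rw [a3]
    generalize A - m = P at *
    generalize A - q / 2 = Q at *
    field_simp
    ring
  have h3 : wf A (q / 2) * wf A m * ((2 * m - q) / 2) ≤ wf A (q / 2) * 1 * ((2 * m - q) / 2) := by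
    apply mul_le_mul_of_nonneg_right _ (by linarith)
    exact mul_le_mul_of_nonneg_left hw1 h2.le
  have h4 : wf A (q / 2) * (1 + (2 * m - q) / 2) ≤ c * (1 + (2 * m - q) / 2) :=
    mul_le_mul_of_nonneg_right hc (by linarith)
  linarith

lemma exp_aux {u : ℝ} (hu : 0 ≤ u) :
    2 * u * (1 + u) * Real.exp (-u) ≤ 4 * (1 - Real.exp (-u) ^ 2) ∧
    (1 + u) * Real.exp (-u) ≤ 1 := by
  have hp := Real.exp_pos (-u)
  have hq := Real.quadratic_le_exp_of_nonneg hu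
  have hl := Real.add_one_le_exp u
  have hm : Real.exp u * Real.exp (-u) = 1 := by rw [← Real.exp_add]; simp
  constructor
  · have h2 : Real.exp (-u) ^ 2 = Real.exp (-(2 * u)) := by
      rw [← Real.exp_nat_mul]; congr 1; push_cast; ring
    have h3 : Real.exp (-(2 * u)) * (1 + 2 * u) ≤ 1 := by
      have := Real.add_one_le_exp (2 * u)
      have hm2 : Real.exp (2 * u) * Real.exp (-(2 * u)) = 1 := by rw [← Real.exp_add]; simp
      have := mul_le_mul_of_nonneg_right this (Real.exp_pos (-(2 * u))).le
      linarith
    have h4 : 2 * u / (1 + 2 * u) ≤ 1 - Real.exp (-u) ^ 2 := by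
      rw [h2, div_le_iff₀ (by linarith)]; nlinarith
    have h5 : (1 + u) * (1 + 2 * u) * Real.exp (-u) ≤ 4 := by
      have : (1 + u) * (1 + 2 * u) ≤ 4 * Real.exp u := by nlinarith
      have := mul_le_mul_of_nonneg_right this hp.le
      nlinarith
    have h6 : 2 * u * (1 + u) * Real.exp (-u) ≤ 4 * (2 * u / (1 + 2 * u)) := by
      rw [← mul_div_assoc, le_div_iff₀ (by linarith)]
      nlinarith
    linarith
  · have := mul_le_mul_of_nonneg_right hl hp.le
    linarith

/-- the final pointwise inequality, normalised -/
lemma rem_alg {B K C2 C4 C c w z r ψ o n2 x2 ththp : ℝ}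
    (hB : 1 ≤ B) (hK : K = 24 * B) (hC2 : 0 ≤ C2) (hC4 : 0 ≤ C4) (hC : C = C2 + K * C4)
    (hc0 : 0 < c) (hcB : 16 * B * c ≤ 1) (hw0 : 0 < w)
    (hr0 : 0 < r) (hr1 : r ≤ 1) (hwz : w * z * r ^ 2 ≤ 4 * c * r * (1 - r ^ 2))
    (hwr : w * r ≤ c) (hψ : 2 ≤ ψ) (ho : o ≤ 2)
    (hn : n2 ≤ 2 * B * w * z * r ^ 2) (hx : x2 ≤ C2 * w ^ 2 * r ^ 2)
    (hth : ththp ≤ -4 + 2 * C4 * c) :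
    3 * n2 + 2 * (K * c * r) * n2 + 2 / 3 * x2 * (1 + K * c * r) - C * c ^ 2 * ψ
      + K * c * r * (ththp / 2) + K * c * r * o * r ^ 2 ≤ 0 := by
  subst hK
  have hKc : 24 * B * c ≤ 3 / 2 := by linarith
  have hkr0 : 0 ≤ 24 * B * c * r := by positivity
  have hkr : 24 * B * c * r ≤ 3 / 2 := by
    have := mul_le_mul hKc hr1 hr0.le (by norm_num : (0:ℝ) ≤ 3 / 2)
    linarith
  set κ := 24 * B * c * r with hκ
  have hc1 : c ≤ 1 := by nlinarith
  have a1 : n2 * (3 + 2 * κ) ≤ 2 * B * w * z * r ^ 2 * (3 + 2 * κ) :=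
    mul_le_mul_of_nonneg_right hn (by linarith)
  have a0 : 0 ≤ 4 * c * r * (1 - r ^ 2) := by
    have : r ^ 2 ≤ 1 := pow_le_one₀ hr0.le hr1
    have : 0 ≤ 1 - r ^ 2 := by linarith
    positivity
  have a2 : w * z * r ^ 2 * (2 * B * (3 + 2 * κ)) ≤ 4 * c * r * (1 - r ^ 2) * (2 * B * (3 + 2 * κ)) :=
    mul_le_mul_of_nonneg_right hwz (by positivity)
  have a3 : 4 * c * r * (1 - r ^ 2) * (2 * B * (3 + 2 * κ)) ≤ 4 * c * r * (1 - r ^ 2) * (2 * B * 6) :=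
    mul_le_mul_of_nonneg_left (by nlinarith) a0
  have a4 : 4 * c * r * (1 - r ^ 2) * (2 * B * 6) = 2 * κ * (1 - r ^ 2) := by
    rw [hκ]; ring
  have a5 : κ * (ththp / 2) ≤ κ * (-2 + C4 * c) :=
    mul_le_mul_of_nonneg_left (by linarith) hkr0
  have a6 : κ * r ^ 2 * o ≤ κ * r ^ 2 * 2 := mul_le_mul_of_nonneg_left ho (by positivity)
  have b1 : (w * r) ^ 2 ≤ c ^ 2 := pow_le_pow_left₀ (by positivity) hwr 2
  have b2 : x2 ≤ C2 * c ^ 2 := by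
    have := mul_le_mul_of_nonneg_left b1 hC2
    nlinarith
  have b3 : x2 * (1 + κ) ≤ C2 * c ^ 2 * (5 / 2) := by
    have h1 : x2 * (1 + κ) ≤ C2 * c ^ 2 * (1 + κ) := mul_le_mul_of_nonneg_right b2 (by linarith)
    have h2 : C2 * c ^ 2 * (1 + κ) ≤ C2 * c ^ 2 * (5 / 2) :=
      mul_le_mul_of_nonneg_left (by linarith) (by positivity)
    linarith
  have b4 : κ * (C4 * c) ≤ 24 * B * C4 * c ^ 2 := by
    have : 24 * B * c * (C4 * c) * r ≤ 24 * B * c * (C4 * c) * 1 :=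
      mul_le_mul_of_nonneg_left hr1 (by positivity)
    rw [hκ]; linarith
  have hCp : 0 ≤ C := by rw [hC]; positivity
  have b5 : C * c ^ 2 * 2 ≤ C * c ^ 2 * ψ := mul_le_mul_of_nonneg_left hψ (by positivity)
  have b6 : C * c ^ 2 = C2 * c ^ 2 + 24 * B * C4 * c ^ 2 := by rw [hC]; ring
  have b7 : 0 ≤ C2 * c ^ 2 := by positivity
  have b8 : 0 ≤ 24 * B * C4 * c ^ 2 := by positivity
  linarith


def al (A C T t : ℝ) : ℝ := Real.exp (2 * C * tc A T t)
def sqth (A C4 T t : ℝ) : ℝ := Real.exp (Real.log (th A C4 T t) / 2)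
def be (A C C4 K T t : ℝ) : ℝ := al A C T t * (K * tc A T t * sqth A C4 T t)
def thD (A C4 T t : ℝ) : ℝ := -4 + C4 * tc A T t + C4 * tc A T t ^ 2 / 2
def alD (A C T t : ℝ) : ℝ := al A C T t * (-(C * tc A T t ^ 2 / (T - t)))
def beD (A C C4 K T t : ℝ) : ℝ := alD A C T t * (K * tc A T t * sqth A C4 T t)
  + al A C T t * (K * (-(tc A T t ^ 2 / (2 * (T - t)))) * sqth A C4 T t
    + K * tc A T t * (sqth A C4 T t * (thD A C4 T t / th A C4 T t / 2)))

lemma al_der {A C T t : ℝ} (ht : t < T) (hA : Real.log (4 * (T - t)) / 2 < A) :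
    HasDerivAt (al A C T) (alD A C T t) t := by
  have h := ((tc_der ht hA).const_mul (2 * C)).exp
  refine h.congr_deriv ?_
  unfold alD al
  have hp : T - t ≠ 0 := by linarith
  field_simp

lemma be_der {A C C4 K T t : ℝ} (ht : t < T) (hA : Real.log (4 * (T - t)) / 2 < A)
    (hth : 0 < th A C4 T t) :
    HasDerivAt (be A C C4 K T) (beD A C C4 K T t) t := by
  have h1 := (((th_der (C4 := C4) ht hA).log hth.ne').div_const 2).exp
  have h2 := ((tc_der ht hA).const_mul K).mul h1
  exact (al_der (C := C) ht hA).mul h2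

lemma rem_le {T t0 A C1 C2 B C4 C K η a : ℝ} {F : Fl} (S : Sys T F)
    (H : Est T t0 A C1 C2 B F)
    (hC4 : 2 * B + 4 * C1 ^ 2 ≤ C4) (hK : K = 24 * B) (hC : C = C2 + K * C4)
    (hη1 : η ≤ 1) (hηC : C4 * η ≤ 1) (hηB : 16 * B * η ≤ 1) (ha0 : t0 ≤ a)
    (ha : ∀ t, a ≤ t → t < T →
      Real.log (4 * (T - t)) / 2 < A ∧ 0 < tc A T t ∧ tc A T t ≤ η) :
    ∀ y t, a ≤ t → t < T → 0 < th A C4 T t ∧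
      3 * al A C T t * F.n y t ^ 2
      + 2 * be A C C4 K T t * Real.exp (-F.m y t) * F.n y t ^ 2
      + 2 / 3 * F.x y t ^ 2 * (al A C T t + be A C C4 K T t * Real.exp (-F.m y t))
      + alD A C T t + beD A C C4 K T t * Real.exp (-F.m y t)
      + be A C C4 K T t * Real.exp (-F.m y t) * om (XX (F.l y t)) * EE (F.m y t) ≤ 0 := by
  have hlow := est_low S H hC4 ha0 (fun t h1 h2 => ⟨(ha t h1 h2).1, (ha t h1 h2).2.1⟩)
  have hB := H.B_ge
  have hC2 := H.C2_ge
  have hC4p : 0 < C4 := by nlinarith [sq_nonneg C1]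
  intro y t h1 h2
  obtain ⟨hlA, hc0, hcη⟩ := ha t h1 h2
  have hp : 0 < T - t := by linarith
  have hC4c : C4 * tc A T t ≤ 1 := (mul_le_mul_of_nonneg_left hcη hC4p.le).trans hηC
  have hBc : 16 * B * tc A T t ≤ 1 :=
    (mul_le_mul_of_nonneg_left hcη (by positivity)).trans hηB
  have hc1 : tc A T t ≤ 1 := hcη.trans hη1
  have hthp : 0 < th A C4 T t := mul_pos (by linarith) hp
  refine ⟨hthp, ?_⟩
  set q := Real.log (th A C4 T t) with hq
  have hzall : ∀ y, 0 ≤ 2 * F.m y t - q := by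
    intro y
    have := (Real.log_le_iff_le_exp hthp).2 (hlow y t h1 h2)
    rw [← hq] at this; linarith
  have hz := hzall y
  have hn := est_p S H (ha0.trans h1) h2 hzall y
  have hm := H.mA y t (ha0.trans h1) h2
  have hw0 := wf_pos hm
  have hqc : wf A (q / 2) ≤ tc A T t := by
    apply wf_mono _ hlA
    have h5 : th A C4 T t ≤ 4 * (T - t) := by
      unfold th
      have : 0 ≤ C4 * tc A T t * (T - t) := by positivity
      nlinarith
    have := Real.log_le_log hthp h5
    rw [← hq] at this; linarith
  have hw := est_wc hm (H.w1 y t (ha0.trans h1) h2) hz hqc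
  have hx := H.xw y t (ha0.trans h1) h2
  have ho : om (XX (F.l y t)) ≤ 2 := om_le (XX_pos _)
  set u := (2 * F.m y t - q) / 2 with hu
  have hu0 : 0 ≤ u := by linarith
  obtain ⟨ex1, ex2⟩ := exp_aux hu0
  set r := Real.exp (-u) with hr
  have hr0 : 0 < r := Real.exp_pos _
  have hr1 : r ≤ 1 := Real.exp_le_one_iff.2 (by linarith)
  have hsr : sqth A C4 T t * Real.exp (-F.m y t) = r := by
    unfold sqth; rw [← Real.exp_add, hr, hu, ← hq]; congr 1; ring
  have hEr : EE (F.m y t) * th A C4 T t = r ^ 2 := by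
    have : th A C4 T t = Real.exp q := (Real.exp_log hthp).symm
    rw [this]; unfold EE; rw [← Real.exp_add, hr, ← Real.exp_nat_mul, hu]; congr 1; push_cast; ring
  have hE1 := one_div_EE (F.m y t)
  set E := EE (F.m y t)
  set θ := th A C4 T t
  set c := tc A T t
  set w := wf A (F.m y t)
  have hEp : 0 < E := Real.exp_pos _
  have key := rem_alg (B := B) (K := K) (C2 := C2) (C4 := C4) (C := C) (c := c) (w := w)
    (z := 2 * F.m y t - q) (r := r) (ψ := θ / (T - t)) (o := om (XX (F.l y t)))
    (n2 := θ * F.n y t ^ 2) (x2 := θ * F.x y t ^ 2) (ththp := thD A C4 T t)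
    hB hK (by linarith) hC4p.le hC hc0 hBc hw0 hr0 hr1 ?_ ?_ ?_ ho ?_ ?_ ?_
  · have hKp : 0 < K := by rw [hK]; positivity
    have hCp : 0 < C := by rw [hC]; positivity
    have hap : 0 < al A C T t := Real.exp_pos _
    set α := al A C T t with hα
    have e1 : be A C C4 K T t * Real.exp (-F.m y t) = α * (K * c * r) := by
      rw [← hsr]; unfold be; ring
    have e2 : beD A C C4 K T t * Real.exp (-F.m y t) =
        α * (K * c * r * (thD A C4 T t / θ / 2) - C * c ^ 2 / (T - t) * (K * c * r)
          - K * (c ^ 2 / (2 * (T - t))) * r) := by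
      rw [← hsr]; unfold beD alD; ring
    have e3 : 0 ≤ C * c ^ 2 / (T - t) * (K * c * r) + K * (c ^ 2 / (2 * (T - t))) * r := by
      positivity
    have e4 : alD A C T t = α * (-(C * c ^ 2 / (T - t))) := rfl
    have e5 : E = r ^ 2 / θ := by rw [← hEr]; field_simp
    have e6 : 2 * be A C C4 K T t * Real.exp (-F.m y t) = 2 * (α * (K * c * r)) := by
      rw [← e1]; ring
    rw [e6, e1, e2, e4, e5]
    have key2 : α / θ * (3 * (θ * F.n y t ^ 2) + 2 * (K * c * r) * (θ * F.n y t ^ 2)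
        + 2 / 3 * (θ * F.x y t ^ 2) * (1 + K * c * r) - C * c ^ 2 * (θ / (T - t))
      + K * c * r * (thD A C4 T t / 2) + K * c * r * om (XX (F.l y t)) * r ^ 2) ≤ 0 :=
      mul_nonpos_of_nonneg_of_nonpos (by positivity) key
    have e7 : 0 ≤ α * (C * c ^ 2 / (T - t) * (K * c * r) + K * (c ^ 2 / (2 * (T - t))) * r) := by
      positivity
    refine le_trans (le_of_eq ?_) (sub_nonpos.2 (key2.trans e7))
    field_simp
    ring
  · have h9 : w * (2 * F.m y t - q) ≤ c * (1 + u) * (2 * F.m y t - q) :=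
      mul_le_mul_of_nonneg_right hw hz
    have h10 := mul_le_mul_of_nonneg_right h9 (sq_nonneg r)
    have h11 := mul_le_mul_of_nonneg_left ex1 (by positivity : 0 ≤ c * r)
    have h12 : 2 * F.m y t - q = 2 * u := by rw [hu]; ring
    rw [h12] at h10 ⊢
    linarith
  · have h9 := mul_le_mul_of_nonneg_right hw hr0.le
    have h10 := mul_le_mul_of_nonneg_left ex2 hc0.le
    linarith
  · rw [le_div_iff₀ hp]
    have : θ = (4 - C4 * c) * (T - t) := rfl
    rw [this]
    exact mul_le_mul_of_nonneg_right (by linarith) hp.le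
  · have h9 := mul_le_mul_of_nonneg_right hn (sq_nonneg r)
    have : F.n y t ^ 2 * Real.exp (2 * F.m y t) * r ^ 2 = θ * F.n y t ^ 2 := by
      rw [← hEr]
      linear_combination (F.n y t ^ 2 * θ) * hE1
    linarith
  · have h9 := mul_le_mul_of_nonneg_left hx.le hthp.le
    have : θ * (C2 * w ^ 2 * E) = C2 * w ^ 2 * r ^ 2 := by rw [← hEr]; ring
    linarith
  · unfold thD
    have : C4 * c * c ≤ C4 * c * 1 := mul_le_mul_of_nonneg_left hc1 (by positivity)
    have : 0 ≤ C4 * c := by positivity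
    nlinarith


lemma JC.slice {a b t : ℝ} {φ : ℝ → ℝ → ℝ} (h : JC a b φ) (h0 : a < t) (h1 : t < b) :
    Continuous (fun y => φ y t) :=
  (h.toJC0 h0).slice le_rfl h1

lemma deriv_int {a T : ℝ} {G Gt : ℝ → ℝ → ℝ} (hc : JC a T G) (hct : JC a T Gt)
    (ht : TD a T G Gt) {t : ℝ} (h1 : a < t) (h2 : t < T) :
    HasDerivAt (fun t => ∫ y in (0:ℝ)..(2 * π), G y t) (∫ y in (0:ℝ)..(2 * π), Gt y t) t := by
  obtain ⟨a1, ha1, ha1'⟩ := exists_between h1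
  obtain ⟨b1, hb1, hb1'⟩ := exists_between h2
  have hK : IsCompact (Icc (0:ℝ) (2 * π) ×ˢ Icc a1 b1) := isCompact_Icc.prod isCompact_Icc
  have hsub : (Icc (0:ℝ) (2 * π) ×ˢ Icc a1 b1) ⊆ univ ×ˢ Ioo a T := fun p hp =>
    ⟨trivial, ha1.trans_le hp.2.1, hp.2.2.trans_lt hb1'⟩
  obtain ⟨Cb, hCb⟩ := hK.exists_bound_of_continuousOn (ContinuousOn.mono hct hsub)
  have hpi : (0:ℝ) ≤ 2 * π := by positivity
  refine (intervalIntegral.hasDerivAt_integral_of_dominated_loc_of_deriv_le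
    (F := fun t y => G y t) (F' := fun t y => Gt y t) (s := Ioo a1 b1) (bound := fun _ => Cb)
    (Ioo_mem_nhds ha1' hb1) ?_ ?_ ?_ ?_ ?_ ?_).2
  · filter_upwards [Ioo_mem_nhds h1 h2] with s hs
    exact (hc.slice hs.1 hs.2).aestronglyMeasurable
  · exact (hc.slice h1 h2).intervalIntegrable _ _
  · exact (hct.slice h1 h2).aestronglyMeasurable
  · refine Filter.Eventually.of_forall (fun y hy s hs => ?_)
    rw [uIoc_of_le hpi] at hy
    exact hCb (y, s) ⟨⟨hy.1.le, hy.2⟩, ⟨hs.1.le, hs.2.le⟩⟩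
  · exact intervalIntegrable_const
  · refine Filter.Eventually.of_forall (fun y hy s hs => ?_)
    exact ht y s (ha1.trans hs.1) (hs.2.trans hb1')

lemma JC.mono' {a b a' : ℝ} {φ : ℝ → ℝ → ℝ} (h : JC a b φ) (h0 : a ≤ a') : JC a' b φ :=
  ContinuousOn.mono h (fun _ hp => ⟨trivial, lt_of_le_of_lt h0 hp.2.1, hp.2.2⟩)
lemma JC0.toJC {a b : ℝ} {φ : ℝ → ℝ → ℝ} (h : JC0 a b φ) : JC a b φ :=
  ContinuousOn.mono h (fun _ hp => ⟨trivial, hp.2.1.le, hp.2.2⟩)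
lemma JC_snd {a b : ℝ} {u : ℝ → ℝ} (h : ContinuousOn u (Ioo a b)) : JC a b (fun _ t => u t) :=
  ContinuousOn.comp h continuousOn_snd (fun _ hp => hp.2)

lemma JC.add {a b : ℝ} {φ ψ : ℝ → ℝ → ℝ} (h : JC a b φ) (h' : JC a b ψ) :
    JC a b (fun y t => φ y t + ψ y t) := ContinuousOn.add h h'
lemma JC.sub {a b : ℝ} {φ ψ : ℝ → ℝ → ℝ} (h : JC a b φ) (h' : JC a b ψ) :
    JC a b (fun y t => φ y t - ψ y t) := ContinuousOn.sub h h'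
lemma JC.mul {a b : ℝ} {φ ψ : ℝ → ℝ → ℝ} (h : JC a b φ) (h' : JC a b ψ) :
    JC a b (fun y t => φ y t * ψ y t) := ContinuousOn.mul h h'
lemma JC.neg {a b : ℝ} {φ : ℝ → ℝ → ℝ} (h : JC a b φ) :
    JC a b (fun y t => -φ y t) := ContinuousOn.neg h
lemma JC.exp {a b : ℝ} {φ : ℝ → ℝ → ℝ} (h : JC a b φ) :
    JC a b (fun y t => Real.exp (φ y t)) := Real.continuous_exp.comp_continuousOn h
lemma JC.pow {a b : ℝ} {φ : ℝ → ℝ → ℝ} (h : JC a b φ) (n : ℕ) :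
    JC a b (fun y t => φ y t ^ n) := ContinuousOn.pow h n
lemma JC.cmul {a b : ℝ} {φ : ℝ → ℝ → ℝ} (c : ℝ) (h : JC a b φ) :
    JC a b (fun y t => c * φ y t) := ContinuousOn.mul continuousOn_const h

lemma functional {T a : ℝ} {F : Fl} (S : Sys T F) (ha : 0 < a) {α β α' β' : ℝ → ℝ}
    (dα : ∀ t, a < t → t < T → HasDerivAt α (α' t) t)
    (dβ : ∀ t, a < t → t < T → HasDerivAt β (β' t) t)
    (cα : ContinuousOn α' (Ioo a T)) (cβ : ContinuousOn β' (Ioo a T))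
    (hα1 : ∀ t, a < t → t < T → 1 ≤ α t) (hβ0 : ∀ t, a < t → t < T → 0 ≤ β t)
    (hrem : ∀ y t, a < t → t < T → 3 * α t * F.n y t ^ 2
      + 2 * β t * Real.exp (-F.m y t) * F.n y t ^ 2
      + 2 / 3 * F.x y t ^ 2 * (α t + β t * Real.exp (-F.m y t))
      + α' t + β' t * Real.exp (-F.m y t)
      + β t * Real.exp (-F.m y t) * om (XX (F.l y t)) * EE (F.m y t) ≤ 0)
    {b : ℝ} (hb : a < b) : ∃ C, ∀ t, b ≤ t → t < T → ∫ y in (0:ℝ)..(2 * π), F.ρ y t ≤ C := by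
  have jρ : JC a T F.ρ := S.c_ρ.toJC.mono' ha.le
  have jm : JC a T F.m := S.c_m.toJC.mono' ha.le
  have jl : JC a T F.l := S.c_l.toJC.mono' ha.le
  have jn : JC a T F.n := S.c_n.mono' ha.le
  have jx : JC a T F.x := S.c_x.mono' ha.le
  have jk : JC a T F.k := S.c_k.mono' ha.le
  have jα : JC a T (fun _ t => α t) := JC_snd (fun t ht =>
    (dα t ht.1 ht.2).continuousAt.continuousWithinAt)
  have jβ : JC a T (fun _ t => β t) := JC_snd (fun t ht =>
    (dβ t ht.1 ht.2).continuousAt.continuousWithinAt)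
  have jα' : JC a T (fun _ t => α' t) := JC_snd cα
  have jβ' : JC a T (fun _ t => β' t) := JC_snd cβ
  set G : ℝ → ℝ → ℝ := fun y t => F.ρ y t * (α t + β t * Real.exp (-F.m y t)) with hG
  set Gt : ℝ → ℝ → ℝ := fun y t =>
    F.ρ y t * (3 * F.k y t + 3 * F.n y t ^ 2 + 2 / 3 * F.x y t ^ 2) *
      (α t + β t * Real.exp (-F.m y t)) + F.ρ y t * (α' t + (β' t * Real.exp (-F.m y t)
      + β t * (Real.exp (-F.m y t) * -(F.k y t + 3 * F.n y t ^ 2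
        - om (XX (F.l y t)) * EE (F.m y t))))) with hGt
  set D : ℝ → ℝ → ℝ := fun y t => F.ρ y t * (F.k y t * (3 * α t + 2 * β t * Real.exp (-F.m y t))
    - 2 * β t * Real.exp (-F.m y t) * F.n y t ^ 2) with hD
  have jG : JC a T G := by
    exact jρ.mul (jα.add (jβ.mul jm.neg.exp))
  have jGt : JC a T Gt := by
    have jE : JC a T (fun y t => EE (F.m y t)) := (JC.cmul (-2) jm).exp
    have jO : JC a T (fun y t => om (XX (F.l y t))) := by
      have : Continuous (fun l => om (XX l)) := by unfold om XX; fun_prop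
      exact this.comp_continuousOn jl
    exact ((jρ.mul (((JC.cmul 3 jk).add (JC.cmul 3 (jn.pow 2))).add
      (JC.cmul (2 / 3) (jx.pow 2)))).mul (jα.add (jβ.mul jm.neg.exp))).add
      (jρ.mul (jα'.add ((jβ'.mul jm.neg.exp).add (jβ.mul (jm.neg.exp.mul
        ((jk.add (JC.cmul 3 (jn.pow 2))).sub (jO.mul jE)).neg)))))
  have jD : JC a T D := by
    exact jρ.mul ((jk.mul ((JC.cmul 3 jα).add ((JC.cmul 2 jβ).mul jm.neg.exp))).sub
      (((JC.cmul 2 jβ).mul jm.neg.exp).mul (jn.pow 2)))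
  have tG : TD a T G Gt := by
    intro y t h1 h2
    have h0 : 0 < t := ha.trans h1
    have := (S.tρ y t h0 h2).mul ((dα t h1 h2).add ((dβ t h1 h2).mul ((S.tm y t h0 h2).neg.exp)))
    exact this
  have hint : ∀ t, a < t → t < T → ∫ y in (0:ℝ)..(2 * π), D y t = 0 := by
    intro t h1 h2
    have h0 : 0 < t := ha.trans h1
    have := intervalIntegral.integral_eq_sub_of_hasDerivAt (a := 0) (b := 2 * π)
      (f := fun y => F.n y t * (3 * α t + 2 * β t * Real.exp (-F.m y t))) (f' := fun y => D y t)
      (fun y _ => by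
        have := (S.dn y t h0 h2).mul ((((S.dm y t h0 h2).neg.exp).const_mul (2 * β t)).const_add
          (3 * α t))
        refine this.congr_deriv ?_
        simp only [hD, Pi.neg_apply]
        ring) ((jD.slice h1 h2).intervalIntegrable _ _)
    rw [this]
    have e1 := S.per_n 0 t
    have e2 := S.per_m 0 t
    rw [zero_add] at e1 e2
    rw [e1, e2, sub_self]
  have hneg : ∀ t, a < t → t < T → ∫ y in (0:ℝ)..(2 * π), Gt y t ≤ 0 := by
    intro t h1 h2
    refine le_of_le_of_eq ?_ (hint t h1 h2)
    apply intervalIntegral.integral_mono_on (by positivity)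
      ((jGt.slice h1 h2).intervalIntegrable _ _) ((jD.slice h1 h2).intervalIntegrable _ _)
    intro y _
    have hρ := S.ρ_pos y t (ha.trans h1).le h2
    have := mul_nonpos_of_nonneg_of_nonpos hρ.le (hrem y t h1 h2)
    simp only [hGt, hD]
    linarith
  have hanti : AntitoneOn (fun t => ∫ y in (0:ℝ)..(2 * π), G y t) (Ioo a T) := by
    apply antitoneOn_of_deriv_nonpos (convex_Ioo a T)
    · exact fun t ht => (deriv_int jG jGt tG ht.1 ht.2).continuousAt.continuousWithinAt
    · rw [interior_Ioo]
      exact fun t ht => (deriv_int jG jGt tG ht.1 ht.2).differentiableAt.differentiableWithinAt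
    · rw [interior_Ioo]
      intro t ht
      rw [(deriv_int jG jGt tG ht.1 ht.2).deriv]
      exact hneg t ht.1 ht.2
  refine ⟨∫ y in (0:ℝ)..(2 * π), G y b, fun t h1 h2 => ?_⟩
  have hat : a < t := hb.trans_le h1
  have h3 := hanti ⟨hb, h1.trans_lt h2⟩ ⟨hat, h2⟩ h1
  refine le_trans ?_ h3
  apply intervalIntegral.integral_mono_on (by positivity)
      ((jρ.slice hat h2).intervalIntegrable _ _) ((jG.slice hat h2).intervalIntegrable _ _)
  intro y _
  have hρ := S.ρ_pos y t (ha.trans hat).le h2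
  have h4 : 0 ≤ β t * Real.exp (-F.m y t) := mul_nonneg (hβ0 t hat h2) (Real.exp_pos _).le
  have := mul_le_mul_of_nonneg_left (by linarith [hα1 t hat h2] :
    1 ≤ α t + β t * Real.exp (-F.m y t)) hρ.le
  simp only [hG]
  linarith

lemma len_bdd {T : ℝ} {F : Fl} (S : Sys T F) (hl0 : ∀ y, F.l y 0 ≤ 0) :
    ∃ C, ∀ t, 0 ≤ t → t < T → ∫ y in (0:ℝ)..(2 * π), F.ρ y t ≤ C := by
  obtain ⟨t0, A, C1, C2, B, H⟩ := exists_est S hl0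
  have hB := H.B_ge
  have hC2 := H.C2_ge
  set C4 := 2 * B + 4 * C1 ^ 2 with hC4
  have hC4p : 0 < C4 := by positivity
  set η := 1 / (1 + C4 + 16 * B) with hη
  have hηp : 0 < η := by positivity
  have e1 : η ≤ 1 := by rw [hη, div_le_one (by positivity)]; linarith
  have e2 : C4 * η ≤ 1 := by rw [hη, mul_one_div, div_le_one (by positivity)]; linarith
  have e3 : 16 * B * η ≤ 1 := by rw [hη, mul_one_div, div_le_one (by positivity)]; linarith
  obtain ⟨a, ha0, haT, ha⟩ := exists_tstar (A := A) H.ht0T hηp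
  have hrem := rem_le S H hC4.ge rfl rfl e1 e2 e3 ha0.le ha
  set K := 24 * B with hK
  set C := C2 + K * C4 with hC
  have ht0 := H.ht0
  have hap : 0 < a := by linarith
  obtain ⟨b, hab, hbT⟩ := exists_between haT
  have ctc : ContinuousOn (tc A T) (Ioo a T) := fun t ht =>
    (tc_der ht.2 (ha t ht.1.le ht.2).1).continuousAt.continuousWithinAt
  have cth : ContinuousOn (th A C4 T) (Ioo a T) := fun t ht =>
    (th_der ht.2 (ha t ht.1.le ht.2).1).continuousAt.continuousWithinAt
  have hth : ∀ t ∈ Ioo a T, th A C4 T t ≠ 0 := fun t ht => (hrem 0 t ht.1.le ht.2).1.ne'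
  have hTt : ∀ t ∈ Ioo a T, T - t ≠ 0 := fun t ht => by linarith [ht.2]
  have h2Tt : ∀ t ∈ Ioo a T, 2 * (T - t) ≠ 0 := fun t ht => by linarith [ht.2]
  have cal : ContinuousOn (al A C T) (Ioo a T) := by
    unfold al; fun_prop
  have csq : ContinuousOn (sqth A C4 T) (Ioo a T) := by
    unfold sqth; exact Real.continuous_exp.comp_continuousOn ((cth.log hth).div_const 2)
  have calD : ContinuousOn (alD A C T) (Ioo a T) := by
    unfold alD
    exact cal.mul (((continuousOn_const.mul (ctc.pow 2)).div (by fun_prop) hTt).neg)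
  have cthD : ContinuousOn (thD A C4 T) (Ioo a T) := by
    unfold thD; fun_prop
  have cbeD : ContinuousOn (beD A C C4 K T) (Ioo a T) := by
    unfold beD
    exact (calD.mul ((continuousOn_const.mul ctc).mul csq)).add (cal.mul
      (((continuousOn_const.mul (((ctc.pow 2).div (by fun_prop) h2Tt).neg)).mul csq).add
      ((continuousOn_const.mul ctc).mul (csq.mul ((cthD.div cth hth).div_const 2)))))
  obtain ⟨Cb, hCb⟩ := functional S hap (α := al A C T) (β := be A C C4 K T) (α' := alD A C T)
    (β' := beD A C C4 K T)
    (fun t h1 h2 => al_der h2 (ha t h1.le h2).1)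
    (fun t h1 h2 => be_der h2 (ha t h1.le h2).1 (hrem 0 t h1.le h2).1)
    calD cbeD
    (fun t h1 h2 => by
      have := (ha t h1.le h2).2.1
      unfold al
      exact Real.one_le_exp (by positivity))
    (fun t h1 h2 => by
      have := (ha t h1.le h2).2.1
      unfold be al sqth
      positivity)
    (fun y t h1 h2 => (hrem y t h1.le h2).2) hab
  have hKc : IsCompact (Icc (0:ℝ) (2 * π) ×ˢ Icc 0 b) := isCompact_Icc.prod isCompact_Icc
  have hsub : (Icc (0:ℝ) (2 * π) ×ˢ Icc 0 b) ⊆ univ ×ˢ Ico 0 T := fun p hp =>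
    ⟨trivial, hp.2.1, hp.2.2.trans_lt hbT⟩
  obtain ⟨R, hR⟩ := hKc.exists_bound_of_continuousOn (ContinuousOn.mono S.c_ρ hsub)
  refine ⟨max Cb (2 * π * R), fun t h1 h2 => ?_⟩
  rcases le_total b t with h | h
  · exact (hCb t h h2).trans (le_max_left _ _)
  · refine le_trans ?_ (le_max_right _ _)
    have : ∫ y in (0:ℝ)..(2 * π), F.ρ y t ≤ ∫ y in (0:ℝ)..(2 * π), R := by
      apply intervalIntegral.integral_mono_on (by positivity)
        ((S.c_ρ.slice h1 h2).intervalIntegrable _ _) intervalIntegrable_const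
      intro y hy
      exact (le_abs_self _).trans (hR (y, t) ⟨hy, h1, h⟩)
    simpa using this


def Sm (T : ℝ) (φ : ℝ → ℝ → ℝ) : Prop :=
  ContDiffOn ℝ (⊤ : ℕ∞) (fun p : ℝ × ℝ => φ p.1 p.2) (univ ×ˢ Ioo 0 T)

lemma isOpen_strip (T : ℝ) : IsOpen ((univ : Set ℝ) ×ˢ Ioo (0:ℝ) T) := isOpen_univ.prod isOpen_Ioo

lemma Sm.fd {T : ℝ} {φ : ℝ → ℝ → ℝ} (h : Sm T φ) {y t : ℝ} (h1 : 0 < t) (h2 : t < T) :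
    HasFDerivAt (fun p : ℝ × ℝ => φ p.1 p.2) (fderiv ℝ (fun p : ℝ × ℝ => φ p.1 p.2) (y, t)) (y, t) :=
  ((ContDiffOn.contDiffAt h ((isOpen_strip T).mem_nhds ⟨trivial, h1, h2⟩)).differentiableAt
    (by simp)).hasFDerivAt

lemma fd_1 {U : ℝ × ℝ → ℝ} {U' : ℝ × ℝ →L[ℝ] ℝ} {y t : ℝ} (h : HasFDerivAt U U' (y, t)) :
    HasDerivAt (fun z => U (z, t)) (U' (1, 0)) y := by
  have h1 : HasDerivAt (fun z : ℝ => ((z, t) : ℝ × ℝ)) (1, 0) y :=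
    (hasDerivAt_id y).prodMk (hasDerivAt_const y t)
  exact h.comp_hasDerivAt y h1

lemma fd_t {U : ℝ × ℝ → ℝ} {U' : ℝ × ℝ →L[ℝ] ℝ} {y t : ℝ} (h : HasFDerivAt U U' (y, t)) :
    HasDerivAt (fun s => U (y, s)) (U' (0, 1)) t := by
  have h1 : HasDerivAt (fun s : ℝ => ((y, s) : ℝ × ℝ)) (0, 1) t :=
    (hasDerivAt_const t y).prodMk (hasDerivAt_id t)
  exact h.comp_hasDerivAt t h1

lemma Sm.pd1_eq {T : ℝ} {φ : ℝ → ℝ → ℝ} (h : Sm T φ) {y t : ℝ} (h1 : 0 < t) (h2 : t < T) :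
    pd1 φ y t = fderiv ℝ (fun p : ℝ × ℝ => φ p.1 p.2) (y, t) (1, 0) :=
  (fd_1 (h.fd (y := y) h1 h2)).deriv

lemma Sm.pdt_eq {T : ℝ} {φ : ℝ → ℝ → ℝ} (h : Sm T φ) {y t : ℝ} (h1 : 0 < t) (h2 : t < T) :
    pdt φ y t = fderiv ℝ (fun p : ℝ × ℝ => φ p.1 p.2) (y, t) (0, 1) :=
  (fd_t (h.fd (y := y) h1 h2)).deriv

lemma Sm.hd1 {T : ℝ} {φ : ℝ → ℝ → ℝ} (h : Sm T φ) {y t : ℝ} (h1 : 0 < t) (h2 : t < T) :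
    HasDerivAt (fun z => φ z t) (pd1 φ y t) y := by
  rw [h.pd1_eq h1 h2]; exact fd_1 (h.fd (y := y) h1 h2)

lemma Sm.hdt {T : ℝ} {φ : ℝ → ℝ → ℝ} (h : Sm T φ) {y t : ℝ} (h1 : 0 < t) (h2 : t < T) :
    HasDerivAt (fun s => φ y s) (pdt φ y t) t := by
  rw [h.pdt_eq h1 h2]; exact fd_t (h.fd (y := y) h1 h2)

lemma Sm.fdc {T : ℝ} {φ : ℝ → ℝ → ℝ} (h : Sm T φ) :
    ContDiffOn ℝ (⊤ : ℕ∞) (fderiv ℝ (fun p : ℝ × ℝ => φ p.1 p.2)) (univ ×ˢ Ioo 0 T) :=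
  ContDiffOn.fderiv_of_isOpen h (isOpen_strip T) (by norm_cast)

lemma Sm.pd1 {T : ℝ} {φ : ℝ → ℝ → ℝ} (h : Sm T φ) : Sm T (pd1 φ) :=
  ContDiffOn.congr (h.fdc.clm_apply (contDiffOn_const (c := ((1, 0) : ℝ × ℝ))))
    (fun p hp => h.pd1_eq hp.2.1 hp.2.2)

lemma Sm.pd1_t {T : ℝ} {φ : ℝ → ℝ → ℝ} (h : Sm T φ) {y t : ℝ} (h1 : 0 < t) (h2 : t < T) :
    HasDerivAt (fun s => _root_.pd1 φ y s) (_root_.pd1 (pdt φ) y t) t := by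
  set U := (fun p : ℝ × ℝ => φ p.1 p.2) with hU
  have hn := (isOpen_strip T).mem_nhds (show ((y, t) : ℝ × ℝ) ∈ univ ×ˢ Ioo 0 T from ⟨trivial, h1, h2⟩)
  have hsym := (ContDiffOn.contDiffAt h hn).isSymmSndFDerivAt
    (by rw [minSmoothness_of_isRCLikeNormedField]; exact WithTop.coe_le_coe.2 (le_top : (2:ℕ∞) ≤ ⊤))
  have hfd : HasFDerivAt (fderiv ℝ U) (fderiv ℝ (fderiv ℝ U) (y, t)) (y, t) :=
    ((h.fdc.contDiffAt hn).differentiableAt (by simp)).hasFDerivAt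
  have ha : HasDerivAt (fun s => fderiv ℝ U (y, s) (1, 0)) (fderiv ℝ (fderiv ℝ U) (y, t) (0, 1) (1, 0)) t := by
    have := fd_t (hfd.clm_apply (hasFDerivAt_const ((1, 0) : ℝ × ℝ) (y, t)))
    refine this.congr_deriv ?_
    simp
  have hb : HasDerivAt (fun z => fderiv ℝ U (z, t) (0, 1)) (fderiv ℝ (fderiv ℝ U) (y, t) (1, 0) (0, 1)) y := by
    have := fd_1 (hfd.clm_apply (hasFDerivAt_const ((0, 1) : ℝ × ℝ) (y, t)))
    refine this.congr_deriv ?_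
    simp
  have hb' : _root_.pd1 (pdt φ) y t = fderiv ℝ (fderiv ℝ U) (y, t) (1, 0) (0, 1) := by
    unfold _root_.pd1
    rw [← hb.deriv]
    congr 1
    ext z
    exact h.pdt_eq h1 h2
  rw [hb', ← hsym.eq]
  refine ha.congr_of_eventuallyEq ?_
  filter_upwards [Ioo_mem_nhds h1 h2] with s hs
  exact h.pd1_eq hs.1 hs.2

lemma Sm.cont {T : ℝ} {φ : ℝ → ℝ → ℝ} (h : Sm T φ) : JC 0 T φ := ContDiffOn.continuousOn h

lemma Sm.Ds {T : ℝ} {ρ φ : ℝ → ℝ → ℝ} (hρ : Sm T ρ) (h0 : ∀ y t, 0 ≤ t → t < T → 0 < ρ y t)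
    (h : Sm T φ) : Sm T (Ds ρ φ) :=
  ContDiffOn.div (Sm.pd1 h) hρ (fun p hp => (h0 p.1 p.2 hp.2.1.le hp.2.2).ne')

lemma Sm.sd {T : ℝ} {ρ φ : ℝ → ℝ → ℝ} (h0 : ∀ y t, 0 ≤ t → t < T → 0 < ρ y t)
    (h : Sm T φ) : SD 0 T ρ φ (_root_.Ds ρ φ) := by
  intro y t h1 h2
  refine (h.hd1 h1 h2).congr_deriv ?_
  unfold _root_.Ds
  have := (h0 y t h1.le h2).ne'
  field_simp

lemma Ds_of_SD {T : ℝ} {ρ φ ψ : ℝ → ℝ → ℝ} (h0 : ∀ y t, 0 ≤ t → t < T → 0 < ρ y t)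
    (h : SD 0 T ρ φ ψ) {y t : ℝ} (h1 : 0 < t) (h2 : t < T) : Ds ρ φ y t = ψ y t := by
  unfold Ds pd1
  rw [(h y t h1 h2).deriv]
  have := (h0 y t h1.le h2).ne'
  field_simp

lemma td_Ds {T : ℝ} {ρ φ Ft F1 σ : ℝ → ℝ → ℝ} (h0 : ∀ y t, 0 ≤ t → t < T → 0 < ρ y t)
    (h : Sm T φ) (hσ : TD 0 T ρ (fun y t => ρ y t * σ y t)) (ht : TD 0 T φ Ft)
    (hF : SD 0 T ρ Ft F1) : TD 0 T (Ds ρ φ) (fun y t => F1 y t - σ y t * Ds ρ φ y t) := by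
  intro y t h1 h2
  have e : pd1 (pdt φ) y t = ρ y t * F1 y t := by
    rw [← (hF y t h1 h2).deriv]
    unfold pd1
    congr 1
    ext z
    exact (ht z t h1 h2).deriv
  have hρ := (h0 y t h1.le h2).ne'
  have := (h.pd1_t (y := y) h1 h2).div (hσ y t h1 h2) hρ
  refine this.congr_deriv ?_
  rw [e]
  unfold Ds
  field_simp

lemma per_Ds {ρ φ : ℝ → ℝ → ℝ} (hρ : Per ρ) (h : Per φ) : Per (Ds ρ φ) := by
  intro y t
  unfold Ds pd1
  rw [hρ y t, ← deriv_comp_add_const]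
  simp only [h _ t]

lemma log_hd {T : ℝ} {f : ℝ → ℝ → ℝ} (hf : Sm T f) (h0 : ∀ y t, 0 ≤ t → t < T → 0 < f y t) :
    Sm T (fun y t => Real.log (f y t)) :=
  ContDiffOn.log hf (fun p hp => (h0 p.1 p.2 hp.2.1.le hp.2.2).ne')


/-- construction of the functions attached to a solution -/
def flm (f g : ℝ → ℝ → ℝ) (y t : ℝ) : ℝ := (Real.log (f y t) + 2 * Real.log (g y t)) / 3
def fll (f g : ℝ → ℝ → ℝ) (y t : ℝ) : ℝ := Real.log (f y t) - Real.log (g y t)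

def mkFl (f g ρ : ℝ → ℝ → ℝ) : Fl where
  ρ := ρ
  m := flm f g
  l := fll f g
  n := Ds ρ (flm f g)
  x := Ds ρ (fll f g)
  k := Ds ρ (Ds ρ (flm f g))
  x1 := Ds ρ (Ds ρ (fll f g))
  k1 := Ds ρ (Ds ρ (Ds ρ (flm f g)))
  k2 := Ds ρ (Ds ρ (Ds ρ (Ds ρ (flm f g))))
  x2 := Ds ρ (Ds ρ (Ds ρ (fll f g)))

lemma fl_exp {a b : ℝ} (ha : 0 < a) (hb : 0 < b) :
    XX (Real.log a - Real.log b) * EE ((Real.log a + 2 * Real.log b) / 3) = 1 / b ^ 2 ∧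
    XX (Real.log a - Real.log b) ^ 4 * EE ((Real.log a + 2 * Real.log b) / 3) = a ^ 2 / b ^ 4 := by
  obtain ⟨u, rfl⟩ : ∃ u, Real.exp u = a := ⟨_, Real.exp_log ha⟩
  obtain ⟨v, rfl⟩ : ∃ u, Real.exp u = b := ⟨_, Real.exp_log hb⟩
  unfold XX EE
  simp only [Real.log_exp, ← Real.exp_nat_mul, ← Real.exp_add, ← Real.exp_sub, one_div,
    ← Real.exp_neg]
  constructor <;> congr 1 <;> push_cast <;> ring

lemma om_sd {T : ℝ} {ρ l x : ℝ → ℝ → ℝ} (h : SD 0 T ρ l x) :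
    SD 0 T ρ (fun y t => om (XX (l y t))) (fun y t => om1 (XX (l y t)) * x y t) := by
  intro y t h1 h2
  have hX := (((h y t h1 h2).const_mul 2).div_const 3).exp
  have := ((hX.const_mul 8).sub ((hX.pow 4).const_mul 2)).div_const 3
  refine this.congr_deriv ?_
  unfold om1 XX; norm_num; ring
lemma om1_sd {T : ℝ} {ρ l x : ℝ → ℝ → ℝ} (h : SD 0 T ρ l x) :
    SD 0 T ρ (fun y t => om1 (XX (l y t))) (fun y t => om2 (XX (l y t)) * x y t) := by
  intro y t h1 h2
  have hX := (((h y t h1 h2).const_mul 2).div_const 3).exp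
  have := (hX.sub (hX.pow 4)).const_mul (16 / 9)
  refine this.congr_deriv ?_
  unfold om2 XX; norm_num; ring
lemma ze_sd {T : ℝ} {ρ l x : ℝ → ℝ → ℝ} (h : SD 0 T ρ l x) :
    SD 0 T ρ (fun y t => ze (XX (l y t))) (fun y t => ze1 (XX (l y t)) * x y t) := by
  intro y t h1 h2
  have hX := (((h y t h1 h2).const_mul 2).div_const 3).exp
  have := (hX.sub (hX.pow 4)).const_mul 4
  refine this.congr_deriv ?_
  unfold ze1 XX; norm_num; ring
lemma EE_sd {T : ℝ} {ρ m n : ℝ → ℝ → ℝ} (h : SD 0 T ρ m n) :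
    SD 0 T ρ (fun y t => EE (m y t)) (fun y t => -2 * n y t * EE (m y t)) := by
  intro y t h1 h2
  have := ((h y t h1 h2).const_mul (-2)).exp
  refine this.congr_deriv ?_
  unfold EE; ring

lemma mkSys {T : ℝ} {f g ρ : ℝ → ℝ → ℝ} (W : WarpedBerger T f g ρ) : Sys T (mkFl f g ρ) := by
  have h0 := W.ρ_pos
  have hsub : (univ : Set ℝ) ×ˢ Ioo 0 T ⊆ univ ×ˢ Ico 0 T := fun p hp =>
    ⟨trivial, hp.2.1.le, hp.2.2⟩
  have sf0 := W.smooth.fst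
  have sg0 := W.smooth.snd.fst
  have sρ0 := W.smooth.snd.snd
  have sf : Sm T f := sf0.mono hsub
  have sg : Sm T g := sg0.mono hsub
  have sρ : Sm T ρ := sρ0.mono hsub
  have su := log_hd sf W.f_pos
  have sv := log_hd sg W.g_pos
  have sm : Sm T (flm f g) := by
    have := ContDiffOn.div_const (ContDiffOn.add su ((contDiffOn_const (c := (2:ℝ))).mul sv)) (c := (3:ℝ))
    exact this
  have sl : Sm T (fll f g) := ContDiffOn.sub su sv
  have sn := Sm.Ds sρ h0 sm
  have sx := Sm.Ds sρ h0 sl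
  have sk := Sm.Ds sρ h0 sn
  have sx1 := Sm.Ds sρ h0 sx
  have sk1 := Sm.Ds sρ h0 sk
  have dm := Sm.sd h0 sm
  have dl := Sm.sd h0 sl
  have dn := Sm.sd h0 sn
  have dx := Sm.sd h0 sx
  have dk := Sm.sd h0 sk
  have dx1 := Sm.sd h0 sx1
  have dk1 := Sm.sd h0 sk1
  set m := flm f g with hm
  set l := fll f g with hl
  set n := Ds ρ m with hn
  set x := Ds ρ l with hx
  set k := Ds ρ n with hk
  set x1 := Ds ρ x with hx1
  set k1 := Ds ρ k with hk1
  set k2 := Ds ρ k1 with hk2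
  set x2 := Ds ρ x1 with hx2
  have per_m : Per m := by
    intro y t; simp only [hm, flm, W.f_per y t, W.g_per y t]
  have per_l : Per l := by
    intro y t; simp only [hl, fll, W.f_per y t, W.g_per y t]
  have per_n : Per n := per_Ds W.ρ_per per_m
  have per_x : Per x := per_Ds W.ρ_per per_l
  have per_k : Per k := per_Ds W.ρ_per per_n
  have c_m : JC0 0 T m := by
    have h1 := sf0.continuousOn.log (fun p hp => (W.f_pos p.1 p.2 hp.2.1 hp.2.2).ne')
    have h2 := sg0.continuousOn.log (fun p hp => (W.g_pos p.1 p.2 hp.2.1 hp.2.2).ne')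
    exact (h1.add (continuousOn_const.mul h2)).div_const 3
  have c_l : JC0 0 T l := by
    have h1 := sf0.continuousOn.log (fun p hp => (W.f_pos p.1 p.2 hp.2.1 hp.2.2).ne')
    have h2 := sg0.continuousOn.log (fun p hp => (W.g_pos p.1 p.2 hp.2.1 hp.2.2).ne')
    exact h1.sub h2
  have fe : ∀ y t, 0 < t → t < T → f y t = Real.exp (m y t + 2 / 3 * l y t) := by
    intro y t h1 h2
    simp only [hm, hl, flm, fll]
    rw [← Real.exp_log (W.f_pos y t h1.le h2), Real.log_exp]; congr 1; ring
  have ge : ∀ y t, 0 < t → t < T → g y t = Real.exp (m y t - 1 / 3 * l y t) := by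
    intro y t h1 h2
    simp only [hm, hl, flm, fll]
    rw [← Real.exp_log (W.g_pos y t h1.le h2), Real.log_exp]; congr 1; ring
  have df : SD 0 T ρ f (fun y t => f y t * (n y t + 2 / 3 * x y t)) := by
    intro y t h1 h2
    have := ((dm y t h1 h2).add ((dl y t h1 h2).const_mul (2 / 3))).exp
    have h3 : (fun z => f z t) = fun z => Real.exp (m z t + 2 / 3 * l z t) :=
      funext (fun z => fe z t h1 h2)
    rw [h3]
    refine this.congr_deriv ?_
    simp only [Pi.add_apply, fe y t h1 h2]; ring
  have dg : SD 0 T ρ g (fun y t => g y t * (n y t - 1 / 3 * x y t)) := by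
    intro y t h1 h2
    have := ((dm y t h1 h2).sub ((dl y t h1 h2).const_mul (1 / 3))).exp
    have h3 : (fun z => g z t) = fun z => Real.exp (m z t - 1 / 3 * l z t) :=
      funext (fun z => ge z t h1 h2)
    rw [h3]
    refine this.congr_deriv ?_
    simp only [Pi.sub_apply, ge y t h1 h2]; ring
  have Df : ∀ y t, 0 < t → t < T → Ds ρ f y t = f y t * (n y t + 2 / 3 * x y t) :=
    fun y t h1 h2 => Ds_of_SD h0 df h1 h2
  have Dg : ∀ y t, 0 < t → t < T → Ds ρ g y t = g y t * (n y t - 1 / 3 * x y t) :=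
    fun y t h1 h2 => Ds_of_SD h0 dg h1 h2
  have DDf : ∀ y t, 0 < t → t < T → Ds ρ (Ds ρ f) y t =
      f y t * ((n y t + 2 / 3 * x y t) ^ 2 + (k y t + 2 / 3 * x1 y t)) := by
    intro y t h1 h2
    refine Ds_of_SD (ψ := fun y t =>
      f y t * ((n y t + 2 / 3 * x y t) ^ 2 + (k y t + 2 / 3 * x1 y t))) h0 ?_ h1 h2
    intro y t h1 h2
    have h3 : (fun z => Ds ρ f z t) = fun z => f z t * (n z t + 2 / 3 * x z t) :=
      funext (fun z => Df z t h1 h2)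
    rw [h3]
    refine ((df y t h1 h2).mul ((dn y t h1 h2).add ((dx y t h1 h2).const_mul (2 / 3)))).congr_deriv ?_
    simp only [Pi.add_apply]; ring
  have DDg : ∀ y t, 0 < t → t < T → Ds ρ (Ds ρ g) y t =
      g y t * ((n y t - 1 / 3 * x y t) ^ 2 + (k y t - 1 / 3 * x1 y t)) := by
    intro y t h1 h2
    refine Ds_of_SD (ψ := fun y t =>
      g y t * ((n y t - 1 / 3 * x y t) ^ 2 + (k y t - 1 / 3 * x1 y t))) h0 ?_ h1 h2
    intro y t h1 h2
    have h3 : (fun z => Ds ρ g z t) = fun z => g z t * (n z t - 1 / 3 * x z t) :=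
      funext (fun z => Dg z t h1 h2)
    rw [h3]
    refine ((dg y t h1 h2).mul ((dn y t h1 h2).sub ((dx y t h1 h2).const_mul (1 / 3)))).congr_deriv ?_
    simp only [Pi.sub_apply]; ring
  have tu : ∀ y t, 0 < t → t < T → HasDerivAt (fun s => Real.log (f y s))
      ((n y t + 2 / 3 * x y t) ^ 2 + (k y t + 2 / 3 * x1 y t)
        + 2 * (n y t - 1 / 3 * x y t) * (n y t + 2 / 3 * x y t)
        - 2 * (f y t ^ 2 / g y t ^ 4)) t := by
    intro y t h1 h2
    have hf := W.f_pos y t h1.le h2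
    have hg := W.g_pos y t h1.le h2
    refine ((sf.hdt h1 h2).log hf.ne').congr_deriv ?_
    rw [W.eq_f y t h1 h2, DDf y t h1 h2, Df y t h1 h2, Dg y t h1 h2]
    field_simp
  have tv : ∀ y t, 0 < t → t < T → HasDerivAt (fun s => Real.log (g y s))
      ((n y t - 1 / 3 * x y t) ^ 2 + (k y t - 1 / 3 * x1 y t)
        + (2 * n y t + 1 / 3 * x y t) * (n y t - 1 / 3 * x y t)
        + 2 * (f y t ^ 2 / g y t ^ 4) - 4 * (1 / g y t ^ 2)) t := by
    intro y t h1 h2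
    have hf := W.f_pos y t h1.le h2
    have hg := W.g_pos y t h1.le h2
    refine ((sg.hdt h1 h2).log hg.ne').congr_deriv ?_
    rw [W.eq_g y t h1 h2, DDg y t h1 h2, Df y t h1 h2, Dg y t h1 h2]
    field_simp
    ring
  have tm : TD 0 T m (fun y t => k y t + 3 * n y t ^ 2 - om (XX (l y t)) * EE (m y t)) := by
    intro y t h1 h2
    obtain ⟨e1, e2⟩ := fl_exp (W.f_pos y t h1.le h2) (W.g_pos y t h1.le h2)
    refine (((tu y t h1 h2).add ((tv y t h1 h2).const_mul 2)).div_const 3).congr_deriv ?_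
    rw [← e1, ← e2]
    simp only [hm, hl, flm, fll, om]
    ring
  have tl : TD 0 T l (fun y t => x1 y t + 3 * n y t * x y t + ze (XX (l y t)) * EE (m y t)) := by
    intro y t h1 h2
    obtain ⟨e1, e2⟩ := fl_exp (W.f_pos y t h1.le h2) (W.g_pos y t h1.le h2)
    refine ((tu y t h1 h2).sub (tv y t h1 h2)).congr_deriv ?_
    rw [← e1, ← e2]
    simp only [hm, hl, flm, fll, ze]
    ring
  have tρ : TD 0 T ρ (fun y t => ρ y t * (3 * k y t + 3 * n y t ^ 2 + 2 / 3 * x y t ^ 2)) := by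
    intro y t h1 h2
    have hf := W.f_pos y t h1.le h2
    have hg := W.g_pos y t h1.le h2
    have hρ := h0 y t h1.le h2
    have h3 := sρ.hdt (y := y) h1 h2
    refine h3.congr_deriv ?_
    have h4 : pdt (fun x τ => Real.log (ρ x τ)) y t = pdt ρ y t / ρ y t := (h3.log hρ.ne').deriv
    have h5 := W.eq_ρ y t h1 h2
    rw [h4, DDf y t h1 h2, DDg y t h1 h2, div_eq_iff hρ.ne'] at h5
    rw [h5]
    field_simp
    ring
  have dom := om_sd dl
  have dom1 := om1_sd dl
  have dze := ze_sd dl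
  have dE := EE_sd dm
  have tn : TD 0 T n (fun y t => k1 y t + 3 * n y t * k y t
    - (3 * n y t ^ 2 + 2 / 3 * x y t ^ 2) * n y t
    + EE (m y t) * (2 * om (XX (l y t)) * n y t - om1 (XX (l y t)) * x y t)) := by
    intro y t h1 h2
    have hF : SD 0 T ρ (fun y t => k y t + 3 * n y t ^ 2 - om (XX (l y t)) * EE (m y t))
      (fun y t => k1 y t + 6 * n y t * k y t - (om1 (XX (l y t)) * x y t * EE (m y t)
        + om (XX (l y t)) * (-2 * n y t * EE (m y t)))) := by
      intro y t h1 h2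
      refine (((dk y t h1 h2).add (((dn y t h1 h2).pow 2).const_mul 3)).sub
        ((dom y t h1 h2).mul (dE y t h1 h2))).congr_deriv ?_
      norm_num; ring
    refine (td_Ds h0 sm tρ tm hF y t h1 h2).congr_deriv ?_
    simp only [← hn]
    ring
  have tx : TD 0 T x (fun y t => x2 y t + 3 * n y t * x1 y t
    - (3 * n y t ^ 2 + 2 / 3 * x y t ^ 2) * x y t
    + EE (m y t) * (ze1 (XX (l y t)) * x y t - 2 * ze (XX (l y t)) * n y t)) := by
    intro y t h1 h2
    have hF : SD 0 T ρ (fun y t => x1 y t + 3 * n y t * x y t + ze (XX (l y t)) * EE (m y t))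
      (fun y t => x2 y t + 3 * k y t * x y t + 3 * n y t * x1 y t
        + (ze1 (XX (l y t)) * x y t * EE (m y t)
        + ze (XX (l y t)) * (-2 * n y t * EE (m y t)))) := by
      intro y t h1 h2
      refine (((dx1 y t h1 h2).add (((dn y t h1 h2).const_mul 3).mul (dx y t h1 h2))).add
        ((dze y t h1 h2).mul (dE y t h1 h2))).congr_deriv ?_
      ring
    refine (td_Ds h0 sl tρ tl hF y t h1 h2).congr_deriv ?_
    simp only [← hx]
    ring
  have tk : TD 0 T k (fun y t => k2 y t + 3 * n y t * k1 y t
    - 12 * n y t ^ 2 * k y t - 4 / 3 * x y t ^ 2 * k y t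
    - 4 / 3 * n y t * x y t * x1 y t
    + EE (m y t) * (2 * om (XX (l y t)) * k y t
      - 4 * om (XX (l y t)) * n y t ^ 2 + 4 * om1 (XX (l y t)) * n y t * x y t
      - om2 (XX (l y t)) * x y t ^ 2 - om1 (XX (l y t)) * x1 y t)) := by
    intro y t h1 h2
    have hF : SD 0 T ρ (fun y t => k1 y t + 3 * n y t * k y t
      - (3 * n y t ^ 2 + 2 / 3 * x y t ^ 2) * n y t
      + EE (m y t) * (2 * om (XX (l y t)) * n y t - om1 (XX (l y t)) * x y t))
      (fun y t => k2 y t + 3 * k y t * k y t + 3 * n y t * k1 y t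
        - ((6 * n y t * k y t + 4 / 3 * x y t * x1 y t) * n y t
          + (3 * n y t ^ 2 + 2 / 3 * x y t ^ 2) * k y t)
        + (-2 * n y t * EE (m y t)) * (2 * om (XX (l y t)) * n y t - om1 (XX (l y t)) * x y t)
        + EE (m y t) * (2 * (om1 (XX (l y t)) * x y t) * n y t + 2 * om (XX (l y t)) * k y t
          - (om2 (XX (l y t)) * x y t * x y t + om1 (XX (l y t)) * x1 y t))) := by
      intro y t h1 h2
      refine ((((dk1 y t h1 h2).add (((dn y t h1 h2).const_mul 3).mul (dk y t h1 h2))).sub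
        (((((dn y t h1 h2).pow 2).const_mul 3).add (((dx y t h1 h2).pow 2).const_mul (2 / 3))).mul
          (dn y t h1 h2))).add
        ((dE y t h1 h2).mul ((((dom y t h1 h2).const_mul 2).mul (dn y t h1 h2)).sub
          ((dom1 y t h1 h2).mul (dx y t h1 h2))))).congr_deriv ?_
      norm_num; ring
    refine (td_Ds h0 sn tρ tn hF y t h1 h2).congr_deriv ?_
    simp only [← hk]
    ring
  exact
    { T_pos := W.T_pos
      ρ_pos := h0
      per_ρ := W.ρ_per
      per_m := per_m
      per_l := per_l
      per_n := per_n
      per_x := per_x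
      per_k := per_k
      c_ρ := sρ0.continuousOn
      c_m := c_m
      c_l := c_l
      c_n := sn.cont
      c_x := sx.cont
      c_k := sk.cont
      dm := dm
      dl := dl
      dn := dn
      dx := dx
      dk := dk
      dx1 := dx1
      dk1 := dk1
      tm := tm
      tl := tl
      tn := tn
      tx := tx
      tk := tk
      tρ := tρ }

/-- Under Assumption A, if the singular set is not all of `S¹ × S³`
(there is `ξ₀` with `liminf_{t↗T} M(ξ₀,t) > 0`), then the total length
`L(t) = ∫_{S¹} ρ(ξ,t) dξ` of the base circle remains bounded as `t ↗ T`. -/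
theorem diameter_bound (T : ℝ) (f g ρ : ℝ → ℝ → ℝ)
    (sol : AssumptionA T f g ρ)
    (h_local : ∃ ξ₀ : ℝ, 0 < Filter.liminf (fun t => M f g ξ₀ t) (𝓝[<] T)) :
    ∃ C : ℝ, ∀ t : ℝ, 0 ≤ t → t < T → (∫ ξ in (0:ℝ)..(2 * π), ρ ξ t) ≤ C := by
  refine len_bdd (mkSys sol.toWarpedBerger) (fun y => ?_)
  exact sub_nonpos.2 (Real.log_le_log (sol.f_pos y 0 le_rfl sol.T_pos) (sol.init_order y))
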